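/- arXiv:2004.05058 — 4 statements merged into one kernel-verified Lean document; each statement's English description precedes it below -/
import Mathlib

section
/- Let G be a countably infinite group and let (F_n) be an arbitrary Følner sequence in G. Then there exists an element x ∈ {0,1}^G which is (F_n)-normal, i.e., for every nonempty finite set K ⊆ G and every block B : K → {0,1}, (1/|F_n|)·|{g ∈ F_n : ∀ h ∈ K, x(h·g) = B(h)}| → 2^{−|K|} as n → ∞. -/
open Filter

/- `(F n)` is a Følner sequence in the group `G`: each `F n` is a nonempty finite
subset and for every `g ∈ G`, `|F n ∩ g (F n)| / |F n| → 1` (note that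
`h ∈ g • F n ↔ g⁻¹ * h ∈ F n`). -/
open scoped Classical in
def IsFolnerGroup {G : Type*} [Group G] (F : ℕ → Finset G) : Prop :=
  (∀ n, (F n).Nonempty) ∧
  ∀ g : G, Tendsto
    (fun n => (((F n).filter (fun h => g⁻¹ * h ∈ F n)).card : ℝ) / (F n).card)
    atTop (nhds 1)

/- `x : G → {0,1}` is `(F n)`-normal. -/
def IsNormalFun {G : Type*} [Mul G] (F : ℕ → Finset G) (x : G → Bool) : Prop :=
  ∀ K : Finset G, K.Nonempty → ∀ B : G → Bool,
    Tendsto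
      (fun n => (((F n).filter (fun g => ∀ h ∈ K, x (h * g) = B h)).card : ℝ) / (F n).card)
      atTop (nhds ((1 / 2 : ℝ) ^ K.card))

namespace NF
open scoped Classical
open Finset

noncomputable def good {G ι : Type*} (E : Finset ι) (T : ι → Finset G)
    (Bad : ι → Finset (Finset G)) (V : Finset G) : Finset (Finset G) :=
  V.powerset.filter (fun A => ∀ e ∈ E, T e ⊆ V → A ∩ T e ∉ Bad e)

theorem mem_good {G ι : Type*} (E : Finset ι) (T : ι → Finset G)
    (Bad : ι → Finset (Finset G)) (V A : Finset G) :
    A ∈ good E T Bad V ↔ A ⊆ V ∧ ∀ e ∈ E, T e ⊆ V → A ∩ T e ∉ Bad e := by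
  simp [good]

theorem good_union {G ι : Type*} (E : Finset ι) (T : ι → Finset G)
    (Bad : ι → Finset (Finset G)) (r : G → ℝ) (hr : ∀ v, 0 < r v) (n : ℕ)
    (ih : ∀ V : Finset G, V.card < n → ∀ v ∉ V,
      2 * ((good E T Bad V).card : ℝ) ≤ r v * (good E T Bad (insert v V)).card)
    (W U : Finset G) (hd : Disjoint W U) (hc : (W ∪ U).card ≤ n) :
    ((good E T Bad W).card : ℝ) ≤ (good E T Bad (W ∪ U)).card * ∏ u ∈ U, (r u / 2) := by
  induction U using Finset.induction_on with
  | empty => simp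
  | insert u U hu IH =>
    have hu' : u ∉ W ∪ U := by
      rw [Finset.disjoint_insert_right] at hd
      simp [hu, hd.1]
    have hd' : Disjoint W U := by
      rw [Finset.disjoint_insert_right] at hd
      exact hd.2
    rw [Finset.union_insert, Finset.card_insert_of_notMem hu'] at hc
    have h1 := IH hd' (by omega)
    have h2 := ih (W ∪ U) (by omega) u hu'
    rw [Finset.prod_insert hu, Finset.union_insert]
    have hp : 0 ≤ ∏ u ∈ U, (r u / 2) := Finset.prod_nonneg fun i _ => by
      have := hr i; positivity
    calc ((good E T Bad W).card : ℝ) ≤ (good E T Bad (W ∪ U)).card * ∏ u ∈ U, (r u / 2) := h1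
      _ ≤ (r u * (good E T Bad (insert u (W ∪ U))).card / 2) * ∏ u ∈ U, (r u / 2) := by
        gcongr; linarith
      _ = _ := by ring

theorem good_step {G ι : Type*} (E : Finset ι) (T : ι → Finset G)
    (Bad : ι → Finset (Finset G)) (r : G → ℝ) (hr : ∀ v, 0 < r v)
    (h : ∀ v, ∑ e ∈ E with v ∈ T e, ((Bad e).card : ℝ) / 2 ^ (T e).card *
      ∏ u ∈ (T e).erase v, r u ≤ 1 - 1 / r v) (n : ℕ) :
    ∀ V : Finset G, V.card = n → ∀ v ∉ V,
      2 * ((good E T Bad V).card : ℝ) ≤ r v * (good E T Bad (insert v V)).card := by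
  induction n using Nat.strong_induction_on with
  | _ n IH =>
  intro V hV v hv
  set Ev := E.filter (fun e => v ∈ T e ∧ T e ⊆ insert v V) with hEv
  -- colourings of `insert v V` whose restriction to `V` is good
  set X := (insert v V).powerset.filter (fun A => A.erase v ∈ good E T Bad V) with hX
  have hXc : X.card = 2 * (good E T Bad V).card := by
    have : X = good E T Bad V ∪ (good E T Bad V).image (insert v) := by
      ext A
      simp only [hX, Finset.mem_filter, Finset.mem_powerset, Finset.mem_union, Finset.mem_image]
      constructor
      · rintro ⟨h1, h2⟩
        by_cases hvA : v ∈ A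
        · right; exact ⟨_, h2, Finset.insert_erase hvA⟩
        · left; rwa [Finset.erase_eq_of_notMem hvA] at h2
      · rintro (h1 | ⟨B, h1, rfl⟩)
        · have h2 := ((mem_good ..).1 h1).1
          have h3 : v ∉ A := fun h => hv (h2 h)
          rw [Finset.erase_eq_of_notMem h3]
          exact ⟨h2.trans (Finset.subset_insert _ _), h1⟩
        · have h2 := ((mem_good ..).1 h1).1
          have h3 : v ∉ B := fun h => hv (h2 h)
          rw [Finset.erase_insert h3]
          exact ⟨Finset.insert_subset_insert _ h2, h1⟩
    rw [this, Finset.card_union_of_disjoint, Finset.card_image_of_injOn]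
    · ring
    · intro A hA B hB hAB
      have h3 : v ∉ A := fun h => hv (((mem_good ..).1 hA).1 h)
      have h4 : v ∉ B := fun h => hv (((mem_good ..).1 hB).1 h)
      have := congrArg (fun C => Finset.erase C v) hAB
      simpa [h3, h4] using this
    · rw [Finset.disjoint_left]
      intro A hA hA'
      obtain ⟨B, -, rfl⟩ := Finset.mem_image.1 hA'
      exact hv (((mem_good ..).1 hA).1 (Finset.mem_insert_self _ _))
  have hsub : X ⊆ good E T Bad (insert v V) ∪
      Ev.biUnion (fun e => X.filter (fun A => A ∩ T e ∈ Bad e)) := by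
    intro A hA
    by_cases hg : A ∈ good E T Bad (insert v V)
    · exact Finset.mem_union_left _ hg
    apply Finset.mem_union_right
    have hA' := hA
    simp only [hX, Finset.mem_filter, Finset.mem_powerset] at hA'
    rw [mem_good] at hg
    push Not at hg
    obtain ⟨e, he, hTe, hb⟩ := hg hA'.1
    rw [Finset.mem_biUnion]
    refine ⟨e, ?_, Finset.mem_filter.2 ⟨hA, hb⟩⟩
    rw [hEv, Finset.mem_filter]
    refine ⟨he, ?_, hTe⟩
    by_contra hvT
    have hTV : T e ⊆ V := by
      intro u hu
      rcases Finset.mem_insert.1 (hTe hu) with rfl | h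
      · exact absurd hu hvT
      · exact h
    have := ((mem_good ..).1 hA'.2).2 e he hTV
    apply this
    rwa [Finset.erase_inter, Finset.erase_eq_of_notMem (fun h => hvT (Finset.mem_inter.1 h).2)]
  have hcard : 2 * (good E T Bad V).card ≤ (good E T Bad (insert v V)).card +
      ∑ e ∈ Ev, (X.filter (fun A => A ∩ T e ∈ Bad e)).card := by
    rw [← hXc]
    refine (Finset.card_le_card hsub).trans ((Finset.card_union_le _ _).trans ?_)
    gcongr
    exact Finset.card_biUnion_le
  have hev : ∀ e ∈ Ev, ((X.filter (fun A => A ∩ T e ∈ Bad e)).card : ℝ) ≤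
      2 * (good E T Bad V).card * (((Bad e).card : ℝ) / 2 ^ (T e).card *
      ∏ u ∈ (T e).erase v, r u) := by
    intro e he
    rw [hEv, Finset.mem_filter] at he
    obtain ⟨heE, hve, hTe⟩ := he
    have h1 : (X.filter (fun A => A ∩ T e ∈ Bad e)).card ≤
        (Bad e ×ˢ good E T Bad (V \ T e)).card := by
      apply Finset.card_le_card_of_injOn (fun A => (A ∩ T e, A \ T e))
      · intro A hA
        have hA1 := (Finset.mem_filter.1 hA).1
        have hA2 := (Finset.mem_filter.1 hA).2
        simp only [hX, Finset.mem_filter, Finset.mem_powerset] at hA1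
        simp only [Finset.coe_product, Set.mem_prod, Finset.mem_coe]
        refine ⟨hA2, ?_⟩
        rw [mem_good]
        constructor
        · intro u hu
          rw [Finset.mem_sdiff] at hu ⊢
          refine ⟨?_, hu.2⟩
          rcases Finset.mem_insert.1 (hA1.1 hu.1) with rfl | h
          · exact absurd hve hu.2
          · exact h
        · intro e' he' hT'
          have h2 := ((mem_good ..).1 hA1.2).2 e' he' (hT'.trans Finset.sdiff_subset)
          convert h2 using 2
          ext u
          simp only [Finset.mem_inter, Finset.mem_sdiff, Finset.mem_erase]
          constructor
          · rintro ⟨⟨h3, h4⟩, h5⟩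
            exact ⟨⟨fun h => h4 (h ▸ hve), h3⟩, h5⟩
          · rintro ⟨⟨h3, h4⟩, h5⟩
            exact ⟨⟨h4, (Finset.mem_sdiff.1 (hT' h5)).2⟩, h5⟩
      · intro A _ B _ hAB
        simp only [Prod.mk.injEq] at hAB
        rw [← Finset.sdiff_union_inter A (T e), ← Finset.sdiff_union_inter B (T e), hAB.1, hAB.2]
    have hsubV : (T e).erase v ⊆ V := by
      intro u hu
      rw [Finset.mem_erase] at hu
      exact (Finset.mem_insert.1 (hTe hu.2)).resolve_left hu.1
    have hun : V \ T e ∪ (T e).erase v = V := by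
      ext u
      simp only [Finset.mem_union, Finset.mem_sdiff, Finset.mem_erase]
      constructor
      · rintro (h | h)
        · exact h.1
        · exact hsubV (Finset.mem_erase.2 h)
      · intro h
        by_cases hu : u ∈ T e
        · right; exact ⟨fun h' => hv (h' ▸ h), hu⟩
        · left; exact ⟨h, hu⟩
    have h2 := good_union E T Bad r hr n (fun W hW w hw => IH _ hW W rfl w hw) (V \ T e)
      ((T e).erase v) (Finset.disjoint_of_subset_right (Finset.erase_subset _ _)
        Finset.sdiff_disjoint) (by rw [hun, hV])
    rw [hun, Finset.prod_div_distrib, Finset.prod_const] at h2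
    have hc : (T e).card = ((T e).erase v).card + 1 := (Finset.card_erase_add_one hve).symm
    rw [Finset.card_product] at h1
    have h1' : ((X.filter (fun A => A ∩ T e ∈ Bad e)).card : ℝ) ≤
        (Bad e).card * (good E T Bad (V \ T e)).card := by exact_mod_cast h1
    refine h1'.trans ((mul_le_mul_of_nonneg_left h2 (Nat.cast_nonneg _)).trans (le_of_eq ?_))
    rw [hc, pow_succ]
    field_simp
  have hcard' : 2 * ((good E T Bad V).card : ℝ) ≤ (good E T Bad (insert v V)).card +
      ∑ e ∈ Ev, ((X.filter (fun A => A ∩ T e ∈ Bad e)).card : ℝ) := by exact_mod_cast hcard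
  have hsum : ∑ e ∈ Ev, ((X.filter (fun A => A ∩ T e ∈ Bad e)).card : ℝ) ≤
      2 * (good E T Bad V).card * (1 - 1 / r v) := by
    refine (Finset.sum_le_sum hev).trans ?_
    rw [← Finset.mul_sum]
    gcongr
    refine le_trans ?_ (h v)
    apply Finset.sum_le_sum_of_subset_of_nonneg
    · intro e he
      rw [hEv, Finset.mem_filter] at he
      exact Finset.mem_filter.2 ⟨he.1, he.2.1⟩
    · intro e _ _
      have : 0 ≤ ∏ u ∈ (T e).erase v, r u := Finset.prod_nonneg fun i _ => (hr i).le
      positivity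
  have hrv := hr v
  have h3 : 2 * ((good E T Bad V).card : ℝ) * (1 / r v) ≤ (good E T Bad (insert v V)).card := by
    linarith
  rw [mul_one_div, div_le_iff₀ hrv] at h3
  linarith

theorem good_nonempty {G ι : Type*} (E : Finset ι) (T : ι → Finset G)
    (Bad : ι → Finset (Finset G)) (r : G → ℝ) (hr : ∀ v, 0 < r v)
    (hT : ∀ e ∈ E, (T e).Nonempty)
    (h : ∀ v, ∑ e ∈ E with v ∈ T e, ((Bad e).card : ℝ) / 2 ^ (T e).card *
      ∏ u ∈ (T e).erase v, r u ≤ 1 - 1 / r v) (V : Finset G) :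
    ∃ A ⊆ V, ∀ e ∈ E, T e ⊆ V → A ∩ T e ∉ Bad e := by
  have key : 0 < (good E T Bad V).card := by
    induction V using Finset.induction_on with
    | empty =>
      rw [Finset.card_pos]
      refine ⟨∅, (mem_good ..).2 ⟨subset_rfl, fun e he hTe => ?_⟩⟩
      exact absurd (Finset.subset_empty.1 hTe) (hT e he).ne_empty
    | insert v V hv IH =>
      have := good_step E T Bad r hr h _ V rfl v hv
      have h1 : (0:ℝ) < (good E T Bad V).card := by exact_mod_cast IH
      have h2 : 0 < r v * (good E T Bad (insert v V)).card := by linarith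
      have := pos_of_mul_pos_right h2 (hr v).le
      exact_mod_cast this
  obtain ⟨A, hA⟩ := Finset.card_pos.1 key
  exact ⟨A, (mem_good ..).1 hA⟩

noncomputable def sg (b : Bool) : ℝ := if b then -1 else 1

theorem sg_cases (b : Bool) : sg b = 1 ∨ sg b = -1 := by cases b <;> simp [sg]

noncomputable def ch {G : Type*} (A : Finset G) (W : Finset G) : ℝ :=
  ∏ u ∈ W, sg (decide (u ∈ A))

theorem prod_sg_cases {G : Type*} (y : G → Bool) (W : Finset G) :
    ∏ u ∈ W, sg (y u) = 1 ∨ ∏ u ∈ W, sg (y u) = -1 := by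
  induction W using Finset.induction_on with
  | empty => simp
  | insert u W hu IH =>
    rw [Finset.prod_insert hu]
    rcases sg_cases (y u) with h | h <;> rcases IH with h' | h' <;> simp [h, h']

theorem sum_ch {G : Type*} (T W : Finset G) (hW : W ⊆ T) (hne : W.Nonempty) :
    ∑ A ∈ T.powerset, ch A W = 0 := by
  have h := Finset.prod_add (fun u => if u ∈ W then (-1:ℝ) else 1) (fun _ => (1:ℝ)) T
  obtain ⟨w, hw⟩ := hne
  rw [Finset.prod_eq_zero (hW hw) (by simp [hw])] at h
  rw [h]
  refine Finset.sum_congr rfl fun A hA => ?_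
  rw [Finset.prod_const_one, mul_one, ch, Finset.prod_ite_mem]
  simp only [sg, decide_eq_true_eq]
  rw [Finset.prod_ite_mem, Finset.inter_comm]

theorem exp_ch (t a : ℝ) (h : a = 1 ∨ a = -1) :
    Real.exp (t * a) = a * Real.sinh t + Real.cosh t := by
  rcases h with rfl | rfl
  · rw [mul_one, one_mul, Real.sinh_add_cosh]
  · rw [mul_neg_one, ← Real.cosh_sub_sinh]; ring

theorem sum_exp {G ι : Type*} (T : Finset G) (S : Finset ι) (U : ι → Finset G)
    (hU : ∀ s ∈ S, U s ⊆ T) (hne : ∀ s ∈ S, (U s).Nonempty)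
    (hd : (S : Set ι).PairwiseDisjoint U) (t : ℝ) :
    ∑ A ∈ T.powerset, Real.exp (t * ∑ s ∈ S, ch A (U s)) = 2 ^ T.card * Real.cosh t ^ S.card := by
  have h1 : ∀ A ∈ T.powerset, Real.exp (t * ∑ s ∈ S, ch A (U s)) =
      ∑ R ∈ S.powerset, ch A (R.biUnion U) * (Real.sinh t ^ R.card *
        Real.cosh t ^ (S \ R).card) := by
    intro A _
    rw [Finset.mul_sum, Real.exp_sum,
      Finset.prod_congr rfl (fun s _ => exp_ch t (ch A (U s)) (prod_sg_cases _ _)),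
      Finset.prod_add]
    refine Finset.sum_congr rfl fun R hR => ?_
    rw [Finset.prod_mul_distrib, Finset.prod_const, Finset.prod_const]
    have : ch A (R.biUnion U) = ∏ s ∈ R, ch A (U s) := by
      unfold ch
      rw [Finset.prod_biUnion]
      exact hd.subset (by exact_mod_cast Finset.mem_powerset.1 hR)
    rw [this]; ring
  rw [Finset.sum_congr rfl h1, Finset.sum_comm, Finset.sum_eq_single ∅]
  · simp [ch]
  · intro R hR hR0
    rw [← Finset.sum_mul, sum_ch, zero_mul]
    · exact Finset.biUnion_subset.2 fun s hs => hU s (Finset.mem_powerset.1 hR hs)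
    · obtain ⟨s, hs⟩ := Finset.nonempty_iff_ne_empty.2 hR0
      obtain ⟨u, hu⟩ := hne s (Finset.mem_powerset.1 hR hs)
      exact ⟨u, Finset.mem_biUnion.2 ⟨s, hs, hu⟩⟩
  · simp

theorem hoeffding {G ι : Type*} (T : Finset G) (S : Finset ι) (U : ι → Finset G)
    (hU : ∀ s ∈ S, U s ⊆ T) (hne : ∀ s ∈ S, (U s).Nonempty)
    (hd : (S : Set ι).PairwiseDisjoint U) (t : ℝ) (ht : 0 ≤ t) :
    ((T.powerset.filter (fun A => t * S.card < |∑ s ∈ S, ch A (U s)|)).card : ℝ) ≤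
      2 * 2 ^ T.card * Real.exp (-(t ^ 2 * S.card / 2)) := by
  have h1 : ((T.powerset.filter (fun A => t * S.card < |∑ s ∈ S, ch A (U s)|)).card : ℝ) *
      Real.exp (t * (t * S.card)) ≤ 2 * (2 ^ T.card * Real.cosh t ^ S.card) := by
    calc _ = ∑ A ∈ T.powerset.filter (fun A => t * S.card < |∑ s ∈ S, ch A (U s)|),
          Real.exp (t * (t * S.card)) := by simp
      _ ≤ ∑ A ∈ T.powerset.filter (fun A => t * S.card < |∑ s ∈ S, ch A (U s)|),
          (Real.exp (t * ∑ s ∈ S, ch A (U s)) + Real.exp (-t * ∑ s ∈ S, ch A (U s))) := by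
        refine Finset.sum_le_sum fun A hA => ?_
        have hA := (Finset.mem_filter.1 hA).2
        rcases lt_abs.1 hA with h | h
        · have : Real.exp (t * (t * S.card)) ≤ Real.exp (t * ∑ s ∈ S, ch A (U s)) := by
            gcongr
          have := Real.exp_pos (-t * ∑ s ∈ S, ch A (U s))
          linarith
        · have : Real.exp (t * (t * S.card)) ≤ Real.exp (-t * ∑ s ∈ S, ch A (U s)) := by
            rw [Real.exp_le_exp, neg_mul, ← mul_neg]
            gcongr
          have := Real.exp_pos (t * ∑ s ∈ S, ch A (U s))
          linarith
      _ ≤ ∑ A ∈ T.powerset,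
          (Real.exp (t * ∑ s ∈ S, ch A (U s)) + Real.exp (-t * ∑ s ∈ S, ch A (U s))) := by
        apply Finset.sum_le_sum_of_subset_of_nonneg (Finset.filter_subset _ _)
        intros; positivity
      _ = _ := by
        rw [Finset.sum_add_distrib, sum_exp T S U hU hne hd, sum_exp T S U hU hne hd,
          Real.cosh_neg]
        ring
  have h2 : Real.cosh t ^ S.card ≤ Real.exp (t ^ 2 * S.card / 2) := by
    calc Real.cosh t ^ S.card ≤ Real.exp (t ^ 2 / 2) ^ S.card := by
          gcongr
          exact Real.cosh_le_exp_half_sq t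
      _ = _ := by rw [← Real.exp_nat_mul]; ring_nf
  have h3 : Real.exp (-(t ^ 2 * S.card / 2)) =
      Real.exp (t ^ 2 * S.card / 2) / Real.exp (t * (t * S.card)) := by
    rw [← Real.exp_sub]; ring_nf
  rw [h3, mul_div_assoc', le_div_iff₀ (Real.exp_pos _)]
  refine h1.trans ?_
  rw [← mul_assoc]
  gcongr

/-- separated sets -/
theorem exists_sep {G : Type*} [Group G] [Infinite G] (L : Finset G) (m : ℕ) :
    ∃ S : Finset G, S.card = m ∧
      (S : Set G).PairwiseDisjoint (fun s => L.image (fun h => h * s)) := by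
  induction m with
  | zero => exact ⟨∅, by simp⟩
  | succ m IH =>
    obtain ⟨S, hS, hd⟩ := IH
    obtain ⟨s, hs⟩ := Infinite.exists_notMem_finset
      (S ∪ (L ×ˢ L ×ˢ S).image (fun p => p.1⁻¹ * p.2.1 * p.2.2))
    rw [Finset.mem_union, not_or] at hs
    refine ⟨insert s S, by rw [Finset.card_insert_of_notMem hs.1, hS], ?_⟩
    rw [Finset.coe_insert]
    refine hd.insert fun t ht _ => ?_
    simp only [Finset.disjoint_left, Finset.mem_image]
    rintro _ ⟨a, ha, rfl⟩ ⟨b, hb, hab⟩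
    apply hs.2
    rw [Finset.mem_image]
    exact ⟨(a, b, t), by simp [ha, hb]; exact ht, by simp only; rw [mul_assoc, hab]; group⟩

/-- from characters to normality -/
theorem normal_of_char {G : Type*} [Group G] (F : ℕ → Finset G) (hF : ∀ n, (F n).Nonempty)
    (x : G → Bool)
    (h : ∀ K : Finset G, K.Nonempty → Tendsto
      (fun n => (∑ g ∈ F n, ∏ k ∈ K, sg (x (k * g))) / (F n).card) atTop (nhds 0))
    (K : Finset G) (B : G → Bool) :
    Tendsto
      (fun n => (((F n).filter (fun g => ∀ h ∈ K, x (h * g) = B h)).card : ℝ) / (F n).card)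
      atTop (nhds ((1 / 2 : ℝ) ^ K.card)) := by
  have h1 : ∀ n, (((F n).filter (fun g => ∀ h ∈ K, x (h * g) = B h)).card : ℝ) / (F n).card =
      ∑ W ∈ K.powerset, ((1/2:ℝ) ^ K.card * ∏ k ∈ W, sg (B k)) *
        ((∑ g ∈ F n, ∏ k ∈ W, sg (x (k * g))) / (F n).card) := by
    intro n
    have h2 : ∀ g, (if ∀ h ∈ K, x (h * g) = B h then (1:ℝ) else 0) =
        ∑ W ∈ K.powerset, ((1/2:ℝ) ^ K.card * ∏ k ∈ W, sg (B k)) *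
          ∏ k ∈ W, sg (x (k * g)) := by
      intro g
      have h3 : (if ∀ h ∈ K, x (h * g) = B h then (1:ℝ) else 0) =
          ∏ k ∈ K, (1/2:ℝ) * (sg (B k) * sg (x (k * g)) + 1) := by
        have h5 := Finset.prod_ite_zero (s := K) (p := fun h => x (h * g) = B h)
          (f := fun _ => (1:ℝ))
        rw [Finset.prod_const_one] at h5
        rw [← h5]
        refine Finset.prod_congr rfl fun k _ => ?_
        cases x (k * g) <;> cases B k <;> norm_num [sg]
      rw [h3, Finset.prod_mul_distrib, Finset.prod_const, Finset.prod_add, Finset.mul_sum]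
      refine Finset.sum_congr rfl fun W _ => ?_
      rw [Finset.prod_mul_distrib]
      simp only [Finset.prod_const_one, mul_one]
      ring
    rw [Finset.card_filter]
    push_cast
    rw [Finset.sum_congr rfl (fun g _ => h2 g), Finset.sum_comm, Finset.sum_div]
    refine Finset.sum_congr rfl fun W _ => ?_
    rw [← Finset.mul_sum, mul_div_assoc]
  simp_rw [h1]
  have h4 : ((1 / 2 : ℝ) ^ K.card) = ∑ W ∈ K.powerset, ((1/2:ℝ) ^ K.card * ∏ k ∈ W, sg (B k)) *
      (if W = ∅ then 1 else 0) := by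
    rw [Finset.sum_eq_single ∅]
    · rw [Finset.prod_empty, if_pos rfl, mul_one, mul_one]
    · intro W _ hW
      rw [if_neg hW, mul_zero]
    · intro h6
      exact absurd (Finset.empty_mem_powerset K) h6
  refine Eq.mpr (congrArg (fun z => Tendsto _ atTop (nhds z)) h4) ?_
  refine tendsto_finsetSum _ fun W _ => Tendsto.const_mul _ ?_
  by_cases hW : W = ∅
  · subst hW
    have : ∀ n, ((F n).card : ℝ) ≠ 0 := fun n =>
      Nat.cast_ne_zero.2 (hF n).card_pos.ne'
    have h6 : ∀ n, (∑ g ∈ F n, ∏ k ∈ (∅ : Finset G), sg (x (k * g))) / ((F n).card : ℝ) = 1 := by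
      intro n
      simp only [Finset.prod_empty, Finset.sum_const, nsmul_eq_mul, mul_one]
      exact div_self (this n)
    simp only [h6, if_true]
    exact tendsto_const_nhds
  · simpa [hW] using h W (Finset.nonempty_iff_ne_empty.2 hW)

theorem exists_size (c δ : ℝ) (hc : 0 < c) (hδ : 0 < δ) (j l : ℕ) (hl : 0 < l) :
    ∃ m : ℕ, 0 < m ∧
      ((l * m : ℕ) : ℝ) * (2 * (j + 1) * Real.exp (-(c * (l * m : ℕ) / 2))) ≤ δ := by
  have h1 : Tendsto (fun y : ℝ => y * Real.exp (-y)) atTop (nhds 0) := by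
    simpa using Real.tendsto_pow_mul_exp_neg_atTop_nhds_zero 1
  have h2 : Tendsto (fun m : ℕ => c / 2 * ((l * m : ℕ) : ℝ)) atTop atTop := by
    apply Tendsto.const_mul_atTop (by positivity)
    apply tendsto_natCast_atTop_atTop.comp
    exact tendsto_id.const_mul_atTop' hl
  have h3 := (h1.comp h2).const_mul (2 / c * (2 * ((j:ℝ) + 1)))
  rw [mul_zero] at h3
  obtain ⟨m, hm, hm0⟩ := ((h3.eventually (gt_mem_nhds hδ)).and (eventually_gt_atTop 0)).exists
  refine ⟨m, hm0, hm.le.trans' (le_of_eq ?_)⟩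
  simp only [Function.comp]
  have : -(c * (l * m : ℕ) / 2) = -(c / 2 * ((l * m : ℕ) : ℝ)) := by ring
  rw [this]
  field_simp

noncomputable def TT {G : Type*} [Group G] (L S : ℕ → Finset G) (e : ℕ × G) : Finset G :=
  (L e.1 ×ˢ S e.1).image (fun p => p.1 * (p.2 * e.2))

noncomputable def BadS {G : Type*} [Group G] (KK : ℕ → Finset (Finset G)) (L S : ℕ → Finset G)
    (ε : ℕ → ℝ) (e : ℕ × G) : Finset (Finset G) :=
  (TT L S e).powerset.filter (fun A => ∃ K ∈ KK e.1, ε e.1 * (S e.1).card <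
    |∑ s ∈ S e.1, ch A (K.image (fun k => k * (s * e.2)))|)

theorem card_TT {G : Type*} [Group G] (L S : ℕ → Finset G) (e : ℕ × G) :
    (TT L S e).card ≤ (L e.1).card * (S e.1).card := by
  refine Finset.card_image_le.trans ?_
  rw [Finset.card_product]

theorem sub_TT {G : Type*} [Group G] (L S : ℕ → Finset G) (e : ℕ × G) (K : Finset G)
    (hK : K ⊆ L e.1) (s : G) (hs : s ∈ S e.1) :
    K.image (fun k => k * (s * e.2)) ⊆ TT L S e := by
  intro u hu
  obtain ⟨k, hk, rfl⟩ := Finset.mem_image.1 hu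
  exact Finset.mem_image.2 ⟨(k, s), by simp [hK hk, hs], rfl⟩

theorem card_BadS {G : Type*} [Group G] (KK : ℕ → Finset (Finset G)) (L S : ℕ → Finset G)
    (ε : ℕ → ℝ) (hε : ∀ j, 0 ≤ ε j)
    (hK : ∀ j, ∀ K ∈ KK j, K.Nonempty ∧ K ⊆ L j)
    (hd : ∀ j, (S j : Set G).PairwiseDisjoint (fun s => (L j).image (fun h => h * s)))
    (hKc : ∀ j, (KK j).card ≤ j + 1) (e : ℕ × G) :
    ((BadS KK L S ε e).card : ℝ) ≤ 2 ^ (TT L S e).card *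
      (2 * (e.1 + 1) * Real.exp (-(ε e.1 ^ 2 * (S e.1).card / 2))) := by
  have h1 : BadS KK L S ε e ⊆ (KK e.1).biUnion (fun K => (TT L S e).powerset.filter (fun A =>
      ε e.1 * (S e.1).card < |∑ s ∈ S e.1, ch A (K.image (fun k => k * (s * e.2)))|)) := by
    intro A hA
    obtain ⟨hA1, K, hK1, hK2⟩ := Finset.mem_filter.1 hA
    exact Finset.mem_biUnion.2 ⟨K, hK1, Finset.mem_filter.2 ⟨hA1, hK2⟩⟩
  have h2 := (Finset.card_le_card h1).trans Finset.card_biUnion_le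
  have h3 : ∀ K ∈ KK e.1, (((TT L S e).powerset.filter (fun A =>
      ε e.1 * (S e.1).card < |∑ s ∈ S e.1, ch A (K.image (fun k => k * (s * e.2)))|)).card : ℝ)
      ≤ 2 * 2 ^ (TT L S e).card * Real.exp (-(ε e.1 ^ 2 * (S e.1).card / 2)) := by
    intro K hKK
    apply hoeffding
    · intro s hs
      exact sub_TT L S e K (hK _ K hKK).2 s hs
    · intro s hs
      exact (hK _ K hKK).1.image _
    · intro s hs t ht hst
      have h4 := hd e.1 hs ht hst
      simp only [Function.onFun] at h4 ⊢
      rw [Finset.disjoint_left] at h4 ⊢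
      intro u hu hu'
      obtain ⟨a, ha, rfl⟩ := Finset.mem_image.1 hu
      obtain ⟨b, hb, hab⟩ := Finset.mem_image.1 hu'
      apply h4 (Finset.mem_image.2 ⟨a, (hK _ K hKK).2 ha, rfl⟩)
      refine Finset.mem_image.2 ⟨b, (hK _ K hKK).2 hb, ?_⟩
      simpa [← mul_assoc] using hab
    · exact hε _
  calc ((BadS KK L S ε e).card : ℝ) ≤ _ := Nat.cast_le.2 h2
    _ ≤ ∑ K ∈ KK e.1, (2 * 2 ^ (TT L S e).card *
        Real.exp (-(ε e.1 ^ 2 * (S e.1).card / 2))) := by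
      push_cast
      exact Finset.sum_le_sum h3
    _ ≤ _ := by
      rw [Finset.sum_const, nsmul_eq_mul]
      have : ((KK e.1).card : ℝ) ≤ e.1 + 1 := by exact_mod_cast hKc e.1
      calc _ ≤ ((e.1:ℝ) + 1) * (2 * 2 ^ (TT L S e).card *
        Real.exp (-(ε e.1 ^ 2 * (S e.1).card / 2))) := by gcongr
        _ = _ := by ring

theorem exists_x {G : Type*} [Group G] (KK : ℕ → Finset (Finset G)) (L S : ℕ → Finset G)
    (ε c : ℕ → ℝ) (hε : ∀ j, 0 ≤ ε j)
    (hK : ∀ j, ∀ K ∈ KK j, K.Nonempty ∧ K ⊆ L j)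
    (hL : ∀ j, (L j).Nonempty) (hS : ∀ j, (S j).Nonempty)
    (hd : ∀ j, (S j : Set G).PairwiseDisjoint (fun s => (L j).image (fun h => h * s)))
    (hKc : ∀ j, (KK j).card ≤ j + 1)
    (hc0 : ∀ j, 0 < c j) (hca : Antitone c) (hc : ∀ j, c j * (L j).card ≤ ε j ^ 2 / 2)
    (hm : ∀ j, (((L j).card * (S j).card : ℕ) : ℝ) *
      (2 * (j + 1) * Real.exp (-(c j * ((L j).card * (S j).card : ℕ) / 2))) ≤
        (1 - 1 / (1 + c (j + 1) / 2)) / 2)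
    (lev : G → ℕ) :
    ∃ x : G → Bool, ∀ j g, (∀ u ∈ TT L S (j, g), j ≤ lev u + 1 ∧ lev u ≤ j) →
      ∀ K ∈ KK j, |∑ s ∈ S j, ∏ k ∈ K, sg (x (k * (s * g)))| ≤ ε j * (S j).card := by
  -- compactness
  let Act : Type _ := {e : ℕ × G // ∀ u ∈ TT L S e, e.1 ≤ lev u + 1 ∧ lev u ≤ e.1}
  let C : Act → Set (G → Bool) := fun e => {x | ∀ K ∈ KK e.1.1,
    |∑ s ∈ S e.1.1, ∏ k ∈ K, sg (x (k * (s * e.1.2)))| ≤ ε e.1.1 * (S e.1.1).card}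
  suffices hne : (⋂ e, C e).Nonempty by
    obtain ⟨x, hx⟩ := hne
    refine ⟨x, fun j g hjg => ?_⟩
    exact Set.mem_iInter.1 hx ⟨(j, g), hjg⟩
  have hcl : ∀ e, IsClosed (C e) := by
    intro e
    simp only [C, Set.ofPred_forall]
    refine isClosed_iInter fun K => isClosed_iInter fun hK => ?_
    refine isClosed_le ?_ continuous_const
    refine continuous_abs.comp (continuous_finsetSum _ fun s _ => continuous_finsetProd _ fun k _ => ?_)
    exact (continuous_of_discreteTopology (f := sg)).comp (continuous_apply _)
  refine CompactSpace.iInter_nonempty hcl ?_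
  intro E
  set r : G → ℝ := fun v => 1 + c (lev v + 1) / 2 with hr
  have hr0 : ∀ v, 0 < r v := fun v => by have := hc0 (lev v + 1); simp only [hr]; positivity
  have hterm : ∀ e : Act, ∀ v, ((BadS KK L S ε e.1).card : ℝ) / 2 ^ (TT L S e.1).card *
      ∏ u ∈ (TT L S e.1).erase v, r u ≤
      2 * (e.1.1 + 1) * Real.exp (-(c e.1.1 * ((L e.1.1).card * (S e.1.1).card : ℕ) / 2)) := by
    intro e v
    set j := e.1.1 with hj
    set M : ℕ := (L j).card * (S j).card with hM
    have h1 : ((BadS KK L S ε e.1).card : ℝ) / 2 ^ (TT L S e.1).card ≤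
        2 * (j + 1) * Real.exp (-(c j * M)) := by
      rw [div_le_iff₀ (by positivity), mul_comm]
      refine (card_BadS KK L S ε hε hK hd hKc e.1).trans ?_
      gcongr
      rw [← hj, hM]
      push_cast
      calc c j * ((L j).card * (S j).card) = (c j * (L j).card) * (S j).card := by ring
        _ ≤ ε j ^ 2 / 2 * (S j).card := by gcongr; exact hc j
        _ = _ := by ring
    have h2 : ∏ u ∈ (TT L S e.1).erase v, r u ≤ Real.exp (c j * M / 2) := by
      calc ∏ u ∈ (TT L S e.1).erase v, r u ≤ ∏ u ∈ (TT L S e.1).erase v, Real.exp (c j / 2) := by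
            refine Finset.prod_le_prod (fun u _ => (hr0 u).le) fun u hu => ?_
            have h3 := (e.2 u (Finset.mem_of_mem_erase hu)).1
            have h4 := hca h3
            have h5 := Real.add_one_le_exp (c j / 2)
            simp only [hr]
            rw [← hj] at h4
            linarith
        _ = Real.exp (c j / 2 * ((TT L S e.1).erase v).card) := by
            rw [Finset.prod_const, ← Real.exp_nat_mul]; ring_nf
        _ ≤ _ := by
            rw [Real.exp_le_exp]
            have h6 : (((TT L S e.1).erase v).card : ℝ) ≤ M := by
              exact_mod_cast (Finset.card_le_card (Finset.erase_subset _ _)).trans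
                (card_TT L S e.1)
            have := hc0 j
            calc c j / 2 * (((TT L S e.1).erase v).card : ℝ) ≤ c j / 2 * M := by gcongr
              _ = _ := by ring
    calc _ ≤ (2 * (j + 1) * Real.exp (-(c j * M))) * Real.exp (c j * M / 2) := by
          apply mul_le_mul h1 h2 _ (by positivity)
          exact Finset.prod_nonneg fun u _ => (hr0 u).le
      _ = _ := by
          rw [mul_assoc, ← Real.exp_add]
          ring_nf
  obtain ⟨A, -, hA⟩ := good_nonempty E (fun e => TT L S e.1) (fun e => BadS KK L S ε e.1) r hr0
    (fun e _ => ((hL _).product (hS _)).image _) (by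
      intro v
      set i := lev v with hi
      set q : ℕ → ℝ := fun j => 2 * (j + 1) *
        Real.exp (-(c j * ((L j).card * (S j).card : ℕ) / 2)) with hq
      have hmaps : ∀ e ∈ E.filter (fun e => v ∈ TT L S e.1), e.1.1 ∈ ({i, i + 1} : Finset ℕ) := by
        intro e he
        have := e.2 v (Finset.mem_filter.1 he).2
        simp only [Finset.mem_insert, Finset.mem_singleton]
        omega
      have hfib : ∀ j, ∑ e ∈ (E.filter (fun e => v ∈ TT L S e.1)).filter (fun e => e.1.1 = j),
          (((BadS KK L S ε e.1).card : ℝ) / 2 ^ (TT L S e.1).card *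
            ∏ u ∈ (TT L S e.1).erase v, r u) ≤ (1 - 1 / (1 + c (j + 1) / 2)) / 2 := by
        intro j
        refine le_trans ?_ (hm j)
        have hcount : ((E.filter (fun e => v ∈ TT L S e.1)).filter (fun e => e.1.1 = j)).card ≤
            (L j).card * (S j).card := by
          rw [← Finset.card_product]
          refine (Finset.card_le_card_of_injOn (t := (L j ×ˢ S j).image
            (fun p => (j, p.2⁻¹ * (p.1⁻¹ * v)))) (fun e : Act => e.1) ?_ ?_).trans
            Finset.card_image_le
          · intro e he
            simp only [Finset.coe_filter, Set.mem_ofPred_eq, Finset.mem_filter] at he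
            obtain ⟨⟨-, h1⟩, h2⟩ := he
            obtain ⟨p, hp, hpv⟩ := Finset.mem_image.1 h1
            rw [h2] at hp
            refine Finset.mem_coe.2 (Finset.mem_image.2 ⟨p, hp, ?_⟩)
            rw [← hpv]
            ext1
            · exact h2.symm
            · simp
          · exact fun a _ b _ hab => Subtype.ext hab
        calc _ ≤ ∑ e ∈ (E.filter (fun e => v ∈ TT L S e.1)).filter (fun e => e.1.1 = j), q j := by
              refine Finset.sum_le_sum fun e he => ?_
              have h2 := (Finset.mem_filter.1 he).2
              have := hterm e v
              rw [h2] at this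
              exact this
          _ ≤ _ := by
              rw [Finset.sum_const, nsmul_eq_mul]
              have h0 : 0 ≤ q j := by simp only [hq]; positivity
              gcongr
      rw [← Finset.sum_fiberwise_of_maps_to hmaps]
      refine (Finset.sum_le_sum fun j _ => hfib j).trans ?_
      rw [Finset.sum_pair (by omega)]
      have h1 : c (i + 1 + 1) ≤ c (i + 1) := hca (by omega)
      have h2 := hc0 (i + 1 + 1)
      have h3 : 1 / (1 + c (i + 1) / 2) ≤ 1 / (1 + c (i + 1 + 1) / 2) := by gcongr
      simp only [hr]
      rw [← hi]
      linarith) (E.biUnion (fun e => TT L S e.1))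
  refine ⟨fun u => decide (u ∈ A), Set.mem_iInter₂.2 fun e he K hKe => ?_⟩
  have hb := hA e he (Finset.subset_biUnion_of_mem (fun e : Act => TT L S e.1) he)
  rw [BadS, Finset.mem_filter, not_and] at hb
  have hb := hb (Finset.mem_powerset.2 Finset.inter_subset_right)
  push Not at hb
  refine (hb K hKe).trans' (le_of_eq ?_)
  congr 1
  refine Finset.sum_congr rfl fun s hs => ?_
  rw [ch, Finset.prod_image (fun a _ b _ hab => mul_right_cancel hab)]
  refine Finset.prod_congr rfl fun k hk => ?_
  have : k * (s * e.1.2) ∈ TT L S e.1 :=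
    sub_TT L S e.1 K (hK _ K hKe).2 s hs (Finset.mem_image_of_mem _ hk)
  simp [this]

theorem abs_sum_le_card {G : Type*} (P Q : Finset G) (hPQ : P ⊆ Q) (f : G → ℝ)
    (hf : ∀ g, |f g| ≤ 1) : |∑ g ∈ Q, f g - ∑ g ∈ P, f g| ≤ Q.card - P.card := by
  have h1 := Finset.sum_sdiff (f := f) hPQ
  have h2 : ∑ g ∈ Q, f g - ∑ g ∈ P, f g = ∑ g ∈ Q \ P, f g := by linarith
  rw [h2]
  refine (Finset.abs_sum_le_sum_abs _ _).trans ((Finset.sum_le_sum fun g _ => hf g).trans ?_)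
  rw [Finset.sum_const, nsmul_eq_mul, mul_one, Finset.card_sdiff_of_subset hPQ,
    Nat.cast_sub (Finset.card_le_card hPQ)]

theorem avg_bound {G : Type*} [Group G] (F S Bd : Finset G) (f : G → ℝ)
    (hf : ∀ g, |f g| ≤ 1) (ε : ℝ) (hε : 0 ≤ ε) (hS : S.Nonempty)
    (hinv : ∀ s ∈ S, (1 - ε) * F.card ≤ ((F.filter (fun h => s⁻¹ * h ∈ F)).card : ℝ))
    (hBd : (Bd.card : ℝ) ≤ ε * F.card)
    (hgood : ∀ g ∈ F, g ∉ Bd → |∑ s ∈ S, f (s * g)| ≤ ε * S.card) :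
    |∑ g ∈ F, f g| ≤ 4 * ε * F.card := by
  have hS0 : (0:ℝ) < S.card := by exact_mod_cast hS.card_pos
  have hshift : ∀ s ∈ S, |∑ g ∈ F, f g - ∑ g ∈ F, f (s * g)| ≤ 2 * ε * F.card := by
    intro s hs
    have h1 := hinv s hs
    set P := F.filter (fun h => s⁻¹ * h ∈ F) with hP
    have h2 := abs_sum_le_card P F (Finset.filter_subset _ _) f hf
    have hPs : P ⊆ F.image (fun g => s * g) := by
      intro h hh
      exact Finset.mem_image.2 ⟨_, (Finset.mem_filter.1 hh).2, by group⟩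
    have h3 := abs_sum_le_card P _ hPs f hf
    rw [Finset.sum_image (fun a _ b _ hab => mul_left_cancel hab),
      Finset.card_image_of_injective _ (mul_right_injective s)] at h3
    rw [abs_le] at h2 h3 ⊢
    constructor <;> linarith [h2.1, h2.2, h3.1, h3.2]
  have h1 : |∑ s ∈ S, (∑ g ∈ F, f g - ∑ g ∈ F, f (s * g))| ≤ S.card * (2 * ε * F.card) := by
    refine (Finset.abs_sum_le_sum_abs _ _).trans ((Finset.sum_le_sum hshift).trans ?_)
    rw [Finset.sum_const, nsmul_eq_mul]
  have h2 : |∑ g ∈ F, ∑ s ∈ S, f (s * g)| ≤ S.card * (2 * ε * F.card) := by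
    calc |∑ g ∈ F, ∑ s ∈ S, f (s * g)| ≤ ∑ g ∈ F, |∑ s ∈ S, f (s * g)| :=
          Finset.abs_sum_le_sum_abs _ _
      _ ≤ ∑ g ∈ F, (ε * S.card + if g ∈ Bd then (S.card : ℝ) else 0) := by
          refine Finset.sum_le_sum fun g hg => ?_
          by_cases hgB : g ∈ Bd
          · rw [if_pos hgB]
            have : |∑ s ∈ S, f (s * g)| ≤ S.card := by
              refine (Finset.abs_sum_le_sum_abs _ _).trans
                ((Finset.sum_le_sum fun s _ => hf _).trans ?_)
              simp
            have : 0 ≤ ε * S.card := by positivity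
            linarith
          · rw [if_neg hgB, add_zero]
            exact hgood g hg hgB
      _ = F.card * (ε * S.card) + (F ∩ Bd).card * S.card := by
          rw [Finset.sum_add_distrib, Finset.sum_const, nsmul_eq_mul, Finset.sum_ite_mem,
            Finset.sum_const, nsmul_eq_mul]
      _ ≤ F.card * (ε * S.card) + (ε * F.card) * S.card := by
          have : ((F ∩ Bd).card : ℝ) ≤ ε * F.card :=
            hBd.trans' (by exact_mod_cast Finset.card_le_card Finset.inter_subset_right)
          gcongr
      _ = _ := by ring
  rw [Finset.sum_sub_distrib, Finset.sum_const, nsmul_eq_mul, Finset.sum_comm] at h1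
  rw [abs_le] at h1 h2 ⊢
  constructor
  · refine le_of_mul_le_mul_left ?_ hS0
    linarith [h1.1, h2.1]
  · refine le_of_mul_le_mul_left ?_ hS0
    linarith [h1.2, h2.2]

theorem folner_card {G : Type*} [Group G] [Infinite G] (F : ℕ → Finset G)
    (hF : IsFolnerGroup F) (M : ℕ) : ∀ᶠ n in atTop, M ≤ (F n).card := by
  obtain ⟨Q, hQ⟩ := Infinite.exists_subset_card_eq G (M * M)
  have h1 : ∀ᶠ n in atTop, ∀ g ∈ Q,
      0 < (((F n).filter (fun h => g⁻¹ * h ∈ F n)).card : ℝ) / (F n).card := by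
    rw [Filter.eventually_all_finset]
    intro g _
    exact (hF.2 g).eventually (lt_mem_nhds one_pos)
  filter_upwards [h1] with n hn
  have h2 : Q ⊆ (F n ×ˢ F n).image (fun p => p.1 * p.2⁻¹) := by
    intro g hg
    have h3 := hn g hg
    have h4 : ((F n).filter (fun h => g⁻¹ * h ∈ F n)).Nonempty := by
      rw [Finset.nonempty_iff_ne_empty]
      intro h5
      simp [h5] at h3
    obtain ⟨h, hh⟩ := h4
    rw [Finset.mem_filter] at hh
    exact Finset.mem_image.2 ⟨(h, g⁻¹ * h), by simp [hh.1, hh.2], by simp⟩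
  have h3 := (Finset.card_le_card h2).trans Finset.card_image_le
  rw [hQ, Finset.card_product] at h3
  exact Nat.mul_self_le_mul_self_iff.1 h3

theorem main {G : Type*} [Group G] [Countable G] [Infinite G]
    (F : ℕ → Finset G) (hF : IsFolnerGroup F) :
    ∃ x : G → Bool, ∀ K : Finset G, K.Nonempty → Tendsto
      (fun n => (∑ g ∈ F n, ∏ k ∈ K, sg (x (k * g))) / (F n).card) atTop (nhds 0) := by
  obtain ⟨en, hen⟩ := exists_surjective_nat (Finset G)
  obtain ⟨γ, hγ⟩ := exists_surjective_nat G
  set KK : ℕ → Finset (Finset G) := fun j =>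
    ((Finset.range (j + 1)).image en).filter (fun K => K.Nonempty) with hKK
  have hKKm : Monotone KK := by
    intro i j hij
    simp only [hKK]
    gcongr
  set L : ℕ → Finset G := fun j => insert 1 ((KK j).biUnion id) with hLdef
  have hLm : Monotone L := by
    intro i j hij
    simp only [hLdef]
    exact Finset.insert_subset_insert _ (Finset.biUnion_subset_biUnion_of_subset_left _ (hKKm hij))
  have hL : ∀ j, (L j).Nonempty := fun j => ⟨1, Finset.mem_insert_self _ _⟩
  have hL0 : ∀ j, (0:ℝ) < (L j).card := fun j => by exact_mod_cast (hL j).card_pos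
  set ε : ℕ → ℝ := fun j => 1 / ((j:ℝ) + 1) with hεdef
  have hε0 : ∀ j, 0 < ε j := fun j => by simp only [hεdef]; positivity
  set c : ℕ → ℝ := fun j => ε j ^ 2 / (2 * (L j).card) with hcdef
  have hc0 : ∀ j, 0 < c j := fun j => by
    have := hε0 j; have := hL0 j; simp only [hcdef]; positivity
  have hca : Antitone c := by
    intro i j hij
    have h1 : ε j ≤ ε i := by simp only [hεdef]; gcongr
    have h2 : ((L i).card : ℝ) ≤ (L j).card := by exact_mod_cast Finset.card_le_card (hLm hij)
    have := hL0 i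
    have := (hε0 j).le
    simp only [hcdef]
    gcongr
  have hc : ∀ j, c j * (L j).card ≤ ε j ^ 2 / 2 := fun j => by
    have := hL0 j
    simp only [hcdef]
    apply le_of_eq
    field_simp
  have hex : ∀ j, ∃ m : ℕ, 0 < m ∧ (((L j).card * m : ℕ) : ℝ) *
      (2 * (j + 1) * Real.exp (-(c j * ((L j).card * m : ℕ) / 2))) ≤
        (1 - 1 / (1 + c (j + 1) / 2)) / 2 := by
    intro j
    apply exists_size _ _ (hc0 j) _ _ _ (hL j).card_pos
    have := hc0 (j + 1)
    have h1 : 1 / (1 + c (j + 1) / 2) < 1 := by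
      rw [div_lt_one (by positivity)]; linarith
    linarith
  choose m hm0 hm using hex
  choose S hSc hSd using fun j => exists_sep (L j) (m j)
  have hS : ∀ j, (S j).Nonempty := fun j => Finset.card_pos.1 (by rw [hSc]; exact hm0 j)
  have hstep : ∀ (j : ℕ) (B : Finset G), ∃ N0, ∀ n ≥ N0,
      (∀ s ∈ S j, (1 - ε j) * (F n).card ≤
        (((F n).filter (fun h => s⁻¹ * h ∈ F n)).card : ℝ)) ∧
      (B.card * ((L j).card * (S j).card)) * (j + 1) ≤ (F n).card := by
    intro j B
    rw [← Filter.eventually_atTop]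
    refine Filter.Eventually.and ?_ (folner_card F hF _)
    rw [Filter.eventually_all_finset]
    intro s _
    have h1 : 1 - ε j < 1 := by linarith [hε0 j]
    filter_upwards [(hF.2 s).eventually (lt_mem_nhds h1)] with n hn
    have h2 : (0:ℝ) < (F n).card := by exact_mod_cast (hF.1 n).card_pos
    rw [lt_div_iff₀ h2] at hn
    exact hn.le
  choose N0 hN0 using hstep
  set W : ℕ → ℕ → Finset G := fun j n => (F n).biUnion (fun g => TT L S (j, g)) with hW
  let st : ℕ → ℕ × Finset G := fun j => Nat.rec (0, ∅) (fun j p =>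
    (max (p.1 + 1) (N0 (j + 1) p.2), p.2 ∪ (Finset.range (j + 1)).image γ ∪
      (Finset.range (max (p.1 + 1) (N0 (j + 1) p.2))).biUnion (W j))) j
  set N : ℕ → ℕ := fun j => (st j).1 with hN
  set B : ℕ → Finset G := fun j => (st j).2 with hB
  have hNs : ∀ j, N (j + 1) = max (N j + 1) (N0 (j + 1) (B j)) := fun j => rfl
  have hBs : ∀ j, B (j + 1) = B j ∪ (Finset.range (j + 1)).image γ ∪
      (Finset.range (N (j + 1))).biUnion (W j) := fun j => rfl
  have hBm : Monotone B := monotone_nat_of_le_succ fun j => by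
    rw [hBs, Finset.union_assoc]; exact Finset.subset_union_left
  have hNm : StrictMono N := strictMono_nat_of_lt_succ fun j => by
    rw [hNs]; exact lt_of_lt_of_le (Nat.lt_succ_self _) (le_max_left _ _)
  have hcov : ∀ u : G, ∃ i, u ∈ B (i + 1) := by
    intro u
    obtain ⟨i, rfl⟩ := hγ u
    refine ⟨i, ?_⟩
    rw [hBs]
    refine Finset.mem_union_left _ (Finset.mem_union_right _ ?_)
    exact Finset.mem_image_of_mem _ (by simp)
  obtain ⟨x, hx⟩ := exists_x KK L S ε c (fun j => (hε0 j).le)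
    (fun j K hK => ⟨(Finset.mem_filter.1 hK).2, fun k hk => Finset.mem_insert_of_mem
      (Finset.mem_biUnion.2 ⟨K, hK, hk⟩)⟩) hL hS hSd
    (fun j => (Finset.card_filter_le _ _).trans (Finset.card_image_le.trans (by simp)))
    hc0 hca hc (fun j => by rw [hSc]; exact hm j) (fun u => Nat.find (hcov u))
  refine ⟨x, fun K hK => ?_⟩
  obtain ⟨J, hJ⟩ := hen K
  have hKJ : ∀ j, J ≤ j → K ∈ KK j := by
    intro j hj
    refine Finset.mem_filter.2 ⟨Finset.mem_image.2 ⟨J, by simp; omega, hJ⟩, hK⟩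
  have hbound : ∀ j, J ≤ j + 1 → ∀ n, N (j + 1) ≤ n → n < N (j + 2) →
      |∑ g ∈ F n, ∏ k ∈ K, sg (x (k * g))| ≤ 4 * ε (j + 1) * (F n).card := by
    intro j hj n hn1 hn2
    have hn0 : N0 (j + 1) (B j) ≤ n := le_trans (by rw [hNs]; exact le_max_right _ _) hn1
    obtain ⟨hinv, hcard⟩ := hN0 (j + 1) (B j) n hn0
    refine avg_bound (F n) (S (j + 1))
      ((B j ×ˢ (L (j + 1) ×ˢ S (j + 1))).image (fun p => p.2.2⁻¹ * (p.2.1⁻¹ * p.1)))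
      (fun g => ∏ k ∈ K, sg (x (k * g))) ?_ _ (hε0 _).le (hS _) hinv ?_ ?_
    · intro g
      rcases prod_sg_cases (fun k => x (k * g)) K with h | h <;> simp [h]
    · have h1 : ((B j ×ˢ (L (j + 1) ×ˢ S (j + 1))).image
          (fun p => p.2.2⁻¹ * (p.2.1⁻¹ * p.1))).card ≤
          (B j).card * ((L (j + 1)).card * (S (j + 1)).card) := by
        refine Finset.card_image_le.trans ?_
        rw [Finset.card_product, Finset.card_product]
      have h2 := (Nat.mul_le_mul_right (j + 1 + 1) h1).trans hcard
      simp only [hεdef]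
      rw [one_div_mul_eq_div, le_div_iff₀ (by positivity)]
      exact_mod_cast h2
    · intro g hg hgB
      refine hx (j + 1) g (fun u hu => ⟨?_, ?_⟩) K (hKJ _ hj)
      · by_contra hlt
        apply hgB
        have h1 : u ∈ B j := hBm (show Nat.find (hcov u) + 1 ≤ j by omega) (Nat.find_spec (hcov u))
        obtain ⟨p, hp, rfl⟩ := Finset.mem_image.1 hu
        refine Finset.mem_image.2 ⟨(p.1 * (p.2 * g), p), ?_, by simp⟩
        exact Finset.mem_product.2 ⟨h1, hp⟩
      · apply Nat.find_min'
        rw [hBs (j + 1)]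
        refine Finset.mem_union_right _ (Finset.mem_biUnion.2 ⟨n, by simpa using hn2, ?_⟩)
        exact Finset.mem_biUnion.2 ⟨g, hg, hu⟩
  rw [Metric.tendsto_atTop]
  intro δ hδ
  obtain ⟨J', hJ'⟩ := exists_nat_gt (4 / δ)
  refine ⟨N (max J J' + 1), fun n hn => ?_⟩
  have hfind : ∃ k, n < N k := ⟨n + 1, lt_of_lt_of_le (Nat.lt_succ_self n) hNm.le_apply⟩
  have hk := Nat.find_spec hfind
  have hkm := fun i => Nat.find_min hfind (m := i)
  generalize Nat.find hfind = k at hk hkm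
  have hk1 : max J J' + 1 < k := hNm.lt_iff_lt.1 (lt_of_le_of_lt hn hk)
  obtain ⟨j, rfl⟩ : ∃ j, k = j + 2 := ⟨k - 2, by omega⟩
  have hb := hbound j (by omega) n (not_lt.1 (hkm (j + 1) (by omega))) hk
  have h2 : (0:ℝ) < (F n).card := by exact_mod_cast (hF.1 n).card_pos
  rw [Real.dist_eq, sub_zero, abs_div, abs_of_pos h2, div_lt_iff₀ h2]
  refine hb.trans_lt (mul_lt_mul_of_pos_right ?_ h2)
  simp only [hεdef]
  have h3 : (J' : ℝ) ≤ j := by exact_mod_cast (by omega : J' ≤ j)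
  rw [mul_one_div, div_lt_iff₀ (by positivity)]
  rw [div_lt_iff₀ hδ] at hJ'
  push_cast
  nlinarith
end NF

/-- For any countably infinite group `G` and any Følner sequence `(F n)` in `G`,
there exists an `(F n)`-normal element `x ∈ {0,1}^G`. -/
theorem exists_isNormalFun
    {G : Type*} [Group G] [Countable G] [Infinite G]
    (F : ℕ → Finset G) (hF : IsFolnerGroup F) :
    ∃ x : G → Bool, IsNormalFun F x := by
  obtain ⟨x, hx⟩ := NF.main F hF
  refine ⟨x, fun K _ B => ?_⟩
  convert NF.normal_of_char F hF.1 x hx K B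
end

section
/- Let A ⊆ ℕ be a classical normal set and let (K_n) be a Følner sequence in (ℕ,×). Then there exists a set E ⊆ ℕ with upper (K_n)-density at least 1/2 such that for every nonempty finite subset {n_1, n_2, …, n_k} ⊆ E, the intersection A/n_1 ∩ A/n_2 ∩ … ∩ A/n_k = {m ∈ ℕ : n_i·m ∈ A for every i = 1,…,k} has positive upper density in (ℕ,+), i.e., limsup_N |(A/n_1 ∩ … ∩ A/n_k) ∩ {1,…,N}|/N > 0. -/
open Filter

/- `A ⊆ ℕ` is a classical normal set: for every nonempty finite `K ⊆ {1,2,...}`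
and every block `B : K → {0,1}`,
`(1/n) · |{m ∈ {1,…,n} : ∀ k ∈ K, 1_A (k+m) = B k}| → 2^{-|K|}`. -/
open scoped Classical in
def ClassicalNormalSet (A : Set ℕ) : Prop :=
  ∀ K : Finset ℕ, K.Nonempty → (∀ k ∈ K, 0 < k) → ∀ B : ℕ → Bool,
    Tendsto
      (fun n =>
        (((Finset.Icc 1 n).filter (fun m => ∀ k ∈ K, (k + m ∈ A ↔ B k = true))).card : ℝ) / n)
      atTop (nhds ((1 / 2 : ℝ) ^ K.card))

/- `(F n)` is a Følner sequence in `(ℕ,×)` (the multiplicative semigroup of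
positive integers): the `F n` are nonempty finite sets of positive integers and
for every `k ≥ 1`, `|F n ∩ (F n)/k| / |F n| → 1` where `F/k = {m : k*m ∈ F}`. -/
def MulFolner (F : ℕ → Finset ℕ) : Prop :=
  (∀ n, (F n).Nonempty) ∧ (∀ n, 0 ∉ F n) ∧
  ∀ k : ℕ, 0 < k → Tendsto
    (fun n => (((F n).filter (fun m => k * m ∈ F n)).card : ℝ) / (F n).card)
    atTop (nhds 1)

/- The upper density (in `(ℕ,+)`) of a set `V ⊆ ℕ`. -/
open scoped Classical in
noncomputable def upperDensity (V : Set ℕ) : ℝ :=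
  limsup (fun N => (((Finset.Icc 1 N).filter (· ∈ V)).card : ℝ) / N) atTop

/- The upper `(K n)`-density of `E ⊆ ℕ` with respect to a sequence of finite sets. -/
open scoped Classical in
noncomputable def upperDensityAlong (K : ℕ → Finset ℕ) (E : Set ℕ) : ℝ :=
  limsup (fun n => (((K n).filter (· ∈ E)).card : ℝ) / (K n).card) atTop


/- The centred indicator of `A`. -/
open scoped Classical in
noncomputable def cind (A : Set ℕ) (k : ℕ) : ℝ := if k ∈ A then 1 / 2 else -1 / 2

lemma cind_sq (A : Set ℕ) (k : ℕ) : cind A k * cind A k = 1 / 4 := by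
  unfold cind; split_ifs <;> norm_num

lemma cind_abs (A : Set ℕ) (k : ℕ) : |cind A k| ≤ 1 := by
  unfold cind; split_ifs <;> norm_num [abs_le]

lemma cind_corr (A : Set ℕ) (hA : ClassicalNormalSet A) (a b : ℕ) (ha : 0 < a) (hb : 0 < b)
    (hab : a ≠ b) :
    Tendsto (fun N : ℕ => (∑ m ∈ Finset.Icc 1 N, cind A (a + m) * cind A (b + m)) / N)
      atTop (nhds 0) := by
  classical
  have hpos : ∀ k ∈ ({a, b} : Finset ℕ), 0 < k := by
    intro k hk; simp at hk; rcases hk with rfl | rfl <;> assumption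
  have h1 := hA {a, b} ⟨a, by simp⟩ hpos (fun _ => true)
  have h0 := hA {a, b} ⟨a, by simp⟩ hpos (fun _ => false)
  have h := ((h1.add h0).const_mul (1 / 2)).sub
    (tendsto_const_nhds (x := (1 / 4 : ℝ)))
  rw [Finset.card_pair hab] at h
  norm_num at h
  refine h.congr' ?_
  filter_upwards [eventually_gt_atTop 0] with N hN
  have hN' : (N : ℝ) ≠ 0 := by positivity
  have key : ∀ m, cind A (a + m) * cind A (b + m) =
      1 / 2 * ((if (a + m ∈ A ∧ b + m ∈ A) then (1 : ℝ) else 0) +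
        (if (a + m ∉ A ∧ b + m ∉ A) then (1 : ℝ) else 0)) - 1 / 4 := by
    intro m
    unfold cind
    by_cases h1 : a + m ∈ A <;> by_cases h2 : b + m ∈ A <;> simp [h1, h2] <;> norm_num
  simp_rw [key]
  rw [Finset.sum_sub_distrib, ← Finset.mul_sum, Finset.sum_add_distrib]
  simp only [Finset.sum_boole, Finset.sum_const, Nat.card_Icc, nsmul_eq_mul]
  field_simp
  push_cast
  simp

lemma window_sq (A : Set ℕ) (hA : ClassicalNormalSet A) (n L : ℕ) (hn : 0 < n) :
    Tendsto (fun N : ℕ => (∑ m ∈ Finset.Icc 1 N,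
      (∑ j ∈ Finset.Icc 1 L, cind A (n * j + m)) ^ 2) / N) atTop (nhds (L / 4)) := by
  have key : ∀ N : ℕ, (∑ m ∈ Finset.Icc 1 N,
      (∑ j ∈ Finset.Icc 1 L, cind A (n * j + m)) ^ 2) / (N : ℝ) =
      ∑ i ∈ Finset.Icc 1 L, ∑ j ∈ Finset.Icc 1 L,
        (∑ m ∈ Finset.Icc 1 N, cind A (n * i + m) * cind A (n * j + m)) / N := by
    intro N
    simp_rw [← Finset.sum_div]
    congr 1
    simp_rw [sq, Finset.sum_mul_sum]
    rw [Finset.sum_comm]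
    refine Finset.sum_congr rfl fun i _ => ?_
    rw [Finset.sum_comm]
  simp_rw [key]
  have : (L / 4 : ℝ) = ∑ i ∈ Finset.Icc 1 L, ∑ j ∈ Finset.Icc 1 L,
      if i = j then (1 / 4 : ℝ) else 0 := by
    rw [Finset.sum_congr rfl (g := fun _ => (1 / 4 : ℝ))]
    · simp; ring
    · intro i hi
      rw [Finset.sum_ite_eq, if_pos hi]
  rw [this]
  refine tendsto_finsetSum _ fun i hi => tendsto_finsetSum _ fun j hj => ?_
  simp only [Finset.mem_Icc] at hi hj
  split_ifs with hij
  · subst hij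
    refine tendsto_const_nhds.congr' ?_
    filter_upwards [eventually_gt_atTop 0] with N hN
    have hN' : (N : ℝ) ≠ 0 := by positivity
    simp_rw [cind_sq]
    simp
    field_simp
  · refine cind_corr A hA _ _ (Nat.mul_pos hn hi.1) (Nat.mul_pos hn hj.1) ?_
    intro h
    exact hij (Nat.eq_of_mul_eq_mul_left hn h)

lemma shift_sum (v : ℕ → ℝ) (hv : ∀ k, |v k| ≤ 1) (N j : ℕ) :
    |∑ t ∈ Finset.Icc 1 N, v (j + t) - ∑ t ∈ Finset.Icc 1 N, v t| ≤ 2 * j := by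
  induction j with
  | zero => simp
  | succ j ih =>
    have : ∑ t ∈ Finset.Icc 1 N, v (j + 1 + t) - ∑ t ∈ Finset.Icc 1 N, v (j + t)
        = v (j + N + 1) - v (j + 1) := by
      clear ih
      induction N with
      | zero => simp
      | succ N ih =>
        rw [Finset.sum_Icc_succ_top (by omega), Finset.sum_Icc_succ_top (by omega)]
        rw [show j + 1 + (N + 1) = j + (N + 1) + 1 by ring,
          show j + (N + 1) = j + N + 1 by ring]
        linarith
    have h1 := hv (j + N + 1)
    have h2 := hv (j + 1)
    rw [abs_le] at *
    push_cast
    constructor <;> linarith [ih.1, ih.2, h1.1, h1.2, h2.1, h2.2]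

lemma cind_mul_avg (A : Set ℕ) (hA : ClassicalNormalSet A) (n : ℕ) (hn : 0 < n) :
    Tendsto (fun N : ℕ => (∑ m ∈ Finset.Icc 1 N, cind A (n * m)) / N) atTop (nhds 0) := by
  rw [Metric.tendsto_atTop']
  intro ε hε
  obtain ⟨L, hL⟩ := exists_nat_gt (4 * n / ε ^ 2)
  have hL0 : (0 : ℝ) < L := lt_of_le_of_lt (by positivity) hL
  have hev : ∀ᶠ N : ℕ in atTop, (∑ m ∈ Finset.Icc 1 N,
      (∑ j ∈ Finset.Icc 1 L, cind A (n * j + m)) ^ 2) / (N : ℝ) < L :=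
    (window_sq A hA n L hn).eventually (gt_mem_nhds (by linarith))
  have hev2 : ∀ᶠ N : ℕ in atTop, (∑ m ∈ Finset.Icc 1 (n * N),
      (∑ j ∈ Finset.Icc 1 L, cind A (n * j + m)) ^ 2) / ((n * N : ℕ) : ℝ) < L :=
    (tendsto_id.const_mul_atTop' hn).eventually hev
  obtain ⟨M, hM⟩ := exists_nat_gt (4 * L / ε)
  obtain ⟨N₀, hN₀⟩ := eventually_atTop.1 hev2
  refine ⟨max N₀ M, fun N hN => ?_⟩
  have hNN : N₀ ≤ N := by omega
  have hNM : M ≤ N := by omega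
  have hNpos : (0 : ℝ) < N := by
    have : 0 < N := by omega
    exact_mod_cast this
  have h := hN₀ N hNN
  have hn' : (0 : ℝ) < n := by exact_mod_cast hn
  push_cast at h
  rw [div_lt_iff₀ (by positivity)] at h
  set S : ℕ → ℝ := fun m => ∑ j ∈ Finset.Icc 1 L, cind A (n * j + m) with hS
  set D := ∑ t ∈ Finset.Icc 1 N, cind A (n * t) with hD
  have h2 : ∑ t ∈ Finset.Icc 1 N, S (n * t) ^ 2 ≤ ∑ m ∈ Finset.Icc 1 (n * N), S m ^ 2 := by
    rw [← Finset.sum_image (f := fun m => S m ^ 2) (g := fun t => n * t)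
      (fun a _ b _ hab => Nat.eq_of_mul_eq_mul_left hn hab)]
    refine Finset.sum_le_sum_of_subset_of_nonneg ?_ (fun _ _ _ => sq_nonneg _)
    intro x hx
    simp only [Finset.mem_image, Finset.mem_Icc] at hx ⊢
    obtain ⟨t, ⟨ht1, ht2⟩, rfl⟩ := hx
    exact ⟨Nat.mul_pos hn ht1, Nat.mul_le_mul_left n ht2⟩
  have h3 := sq_sum_le_card_mul_sum_sq (s := Finset.Icc 1 N) (f := fun t => S (n * t))
  simp only [Nat.card_Icc, Nat.add_sub_cancel] at h3
  have h4 : |∑ t ∈ Finset.Icc 1 N, S (n * t) - L * D| ≤ L * (2 * L) := by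
    have : ∑ t ∈ Finset.Icc 1 N, S (n * t) - L * D = ∑ j ∈ Finset.Icc 1 L,
        (∑ t ∈ Finset.Icc 1 N, cind A (n * (j + t)) - D) := by
      rw [Finset.sum_sub_distrib, hS, Finset.sum_comm]
      simp [mul_add]
    rw [this]
    refine (Finset.abs_sum_le_sum_abs _ _).trans ?_
    refine (Finset.sum_le_sum (g := fun _ => (2 * L : ℝ)) fun j hj => ?_).trans (by simp)
    refine (shift_sum (fun t => cind A (n * t)) (fun k => cind_abs A _) N j).trans ?_
    have : (j : ℝ) ≤ L := by exact_mod_cast (Finset.mem_Icc.1 hj).2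
    linarith
  set Q := ∑ t ∈ Finset.Icc 1 N, S (n * t) with hQ
  -- Q ^ 2 ≤ N * (L * (n N))
  have h5 : Q ^ 2 < (L * N * ε / 2) ^ 2 := by
    have e1 : Q ^ 2 < N * (L * (n * N)) := lt_of_le_of_lt h3 (by gcongr; linarith)
    rw [div_lt_iff₀ (by positivity)] at hL
    have e2 : (N * (L * (n * N)) : ℝ) ≤ (L * N * ε / 2) ^ 2 := by
      have : (L * N ^ 2 : ℝ) * (4 * n) ≤ (L * N ^ 2) * (L * ε ^ 2) := by gcongr
      nlinarith
    linarith
  have h6 : |Q| < L * N * ε / 2 := abs_lt_of_sq_lt_sq h5 (by positivity)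
  have h7 : L * (2 * L) < L * N * ε / 2 := by
    rw [div_lt_iff₀ hε] at hM
    have : (M : ℝ) ≤ N := by exact_mod_cast hNM
    have : 4 * (L : ℝ) < N * ε := lt_of_lt_of_le hM (by gcongr)
    nlinarith
  have h8 : L * |D| < L * (N * ε) := by
    rw [← abs_of_pos hL0, ← abs_mul, abs_of_pos hL0]
    rw [abs_lt] at *
    rw [abs_le] at h4
    constructor <;> linarith [h4.1, h4.2, h6.1, h6.2]
  have h9 := lt_of_mul_lt_mul_left h8 hL0.le
  rw [Real.dist_eq, sub_zero, abs_div, abs_of_pos hNpos, div_lt_iff₀ hNpos]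
  linarith

open scoped Classical in
lemma density_div (A : Set ℕ) (hA : ClassicalNormalSet A) (n : ℕ) (hn : 0 < n) :
    Tendsto (fun N : ℕ => (((Finset.Icc 1 N).filter (fun m => n * m ∈ A)).card : ℝ) / N)
      atTop (nhds (1 / 2)) := by
  have h := (cind_mul_avg A hA n hn).add_const (1 / 2)
  rw [zero_add] at h
  refine h.congr' ?_
  filter_upwards [eventually_gt_atTop 0] with N hN
  have hN' : (N : ℝ) ≠ 0 := by positivity
  have key : ∀ m, cind A (n * m) = (if n * m ∈ A then (1 : ℝ) else 0) - 1 / 2 := by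
    intro m; unfold cind; split_ifs <;> norm_num
  simp_rw [key]
  rw [Finset.sum_sub_distrib]
  simp only [Finset.sum_boole, Finset.sum_const, Nat.card_Icc, nsmul_eq_mul]
  field_simp
  push_cast
  simp

open MeasureTheory in
/- The empirical measure on `ℕ → Bool` of the points `T 1, …, T (N+1)`. -/
noncomputable def empMeas (T : ℕ → (ℕ → Bool)) (N : ℕ) : Measure (ℕ → Bool) :=
  ((N + 1 : ℕ) : ENNReal)⁻¹ • ∑ m ∈ Finset.Icc 1 (N + 1), Measure.dirac (T m)

open scoped Classical in
lemma empMeas_apply (T : ℕ → (ℕ → Bool)) (N : ℕ) (C : Set (ℕ → Bool)) (hC : MeasurableSet C) :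
    empMeas T N C = ((N + 1 : ℕ) : ENNReal)⁻¹ *
      (((Finset.Icc 1 (N + 1)).filter (fun m => T m ∈ C)).card : ENNReal) := by
  unfold empMeas
  simp only [MeasureTheory.Measure.smul_apply, MeasureTheory.Measure.finsetSum_apply, smul_eq_mul,
    MeasureTheory.Measure.dirac_apply' _ hC, Set.indicator_apply, Pi.one_apply, Finset.sum_boole]

instance empMeas_prob (T : ℕ → (ℕ → Bool)) (N : ℕ) :
    MeasureTheory.IsProbabilityMeasure (empMeas T N) := by
  classical
  constructor
  rw [empMeas_apply T N _ MeasurableSet.univ]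
  simp only [Set.mem_univ, Finset.filter_true, Nat.card_Icc, Nat.add_sub_cancel]
  exact ENNReal.inv_mul_cancel (by simp) (by simp)

open scoped Classical in
lemma exists_limit_measure (T : ℕ → (ℕ → Bool)) :
    ∃ (p : Filter ℕ) (μ : MeasureTheory.ProbabilityMeasure (ℕ → Bool)), p.NeBot ∧ p ≤ atTop ∧
      ∀ C : Set (ℕ → Bool), IsClopen C →
        Tendsto (fun N : ℕ => (((Finset.Icc 1 N).filter (fun m => T m ∈ C)).card : ℝ) / N)
          p (nhds ((μ C : NNReal) : ℝ)) := by
  let μs : ℕ → MeasureTheory.ProbabilityMeasure (ℕ → Bool) := fun N => ⟨empMeas T N, inferInstance⟩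
  let q : Ultrafilter ℕ := Ultrafilter.of atTop
  have hq : (q : Filter ℕ) ≤ atTop := Ultrafilter.of_le _
  obtain ⟨μ, -, hμ⟩ := isCompact_univ.ultrafilter_le_nhds (q.map μs) (by simp)
  refine ⟨Filter.map (· + 1) (q : Filter ℕ), μ, inferInstance, ?_, ?_⟩
  · exact (Filter.map_mono hq).trans (tendsto_add_atTop_nat 1)
  · intro C hC
    have hμ' : Tendsto μs q (nhds μ) := hμ
    have h := MeasureTheory.ProbabilityMeasure.tendsto_measure_of_isClopen_of_tendsto hμ' hC
    rw [Filter.tendsto_map'_iff]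
    refine ((NNReal.continuous_coe.tendsto _).comp h).congr fun N => ?_
    have h1 : μs N C = ((empMeas T N) C).toNNReal := rfl
    simp only [Function.comp, h1, empMeas_apply T N C hC.isOpen.measurableSet]
    rw [ENNReal.toNNReal_mul, ENNReal.toNNReal_inv, ENNReal.toNNReal_natCast,
      ENNReal.toNNReal_natCast, NNReal.coe_mul, NNReal.coe_inv, NNReal.coe_natCast,
      NNReal.coe_natCast, div_eq_inv_mul]

lemma le_limsup_frac {p : Filter ℕ} [p.NeBot] (hp : p ≤ atTop) (u : ℕ → ℝ) (hu : ∀ n, u n ≤ 1)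
    {c : ℝ} (h : Tendsto u p (nhds c)) : c ≤ limsup u atTop := by
  rw [← h.limsup_eq]
  exact limsup_le_limsup_of_le hp h.isCoboundedUnder_le (isBoundedUnder_of ⟨1, hu⟩)

lemma frac_le_one (s : Finset ℕ) (P : ℕ → Prop) [DecidablePred P] :
    ((s.filter P).card : ℝ) / s.card ≤ 1 :=
  div_le_one_of_le₀ (by exact_mod_cast Finset.card_filter_le _ _) (by positivity)

open MeasureTheory in
/- Bergelson's intersectivity argument on the space `ℕ → Bool`. -/
lemma exists_good_point (μ : Measure (ℕ → Bool)) [IsProbabilityMeasure μ]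
    (hμ : ∀ n, 0 < n → μ {x | x n = true} = 1 / 2)
    (K : ℕ → Finset ℕ) (hK : ∀ n, (K n).Nonempty) (hK0 : ∀ n, 0 ∉ K n)
    (Z : Set (ℕ → Bool)) (hZ : μ Z = 0) :
    ∃ x, x ∉ Z ∧
      (1 / 2 : ℝ) ≤ limsup (fun n => (((K n).filter (fun k => x k = true)).card : ℝ) / (K n).card)
        atTop := by
  let f : ℕ → (ℕ → Bool) → ENNReal := fun n x =>
    ((K n).card : ENNReal)⁻¹ * ∑ k ∈ K n, Set.indicator {x : ℕ → Bool | x k = true} 1 x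
  have hms : ∀ k, MeasurableSet {x : ℕ → Bool | x k = true} := fun k =>
    measurableSet_eq_fun (measurable_pi_apply k) measurable_const
  have hfm : ∀ n, Measurable (f n) := fun n =>
    (Finset.measurable_sum _ fun k _ => measurable_one.indicator (hms k)).const_mul _
  have hfv : ∀ n x, f n x =
      ENNReal.ofReal ((((K n).filter (fun k => x k = true)).card : ℝ) / (K n).card) := by
    intro n x
    have : (0 : ℝ) < (K n).card := by exact_mod_cast (hK n).card_pos
    rw [ENNReal.ofReal_div_of_pos this]
    simp only [f, Set.indicator_apply, Set.mem_ofPred_eq, Pi.one_apply, Finset.sum_boole,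
      ENNReal.ofReal_natCast]
    rw [ENNReal.div_eq_inv_mul]
  have hf1 : ∀ n x, f n x ≤ 1 := by
    intro n x
    rw [hfv]
    exact ENNReal.ofReal_le_one.2 (frac_le_one _ _)
  have hint : ∀ n, ∫⁻ x, f n x ∂μ = 1 / 2 := by
    intro n
    simp only [f]
    rw [lintegral_const_mul _ (Finset.measurable_sum _ fun k _ => measurable_one.indicator (hms k)),
      lintegral_finsetSum _ (fun k _ => measurable_one.indicator (hms k))]
    rw [Finset.sum_congr rfl (g := fun _ => (1 / 2 : ENNReal))]
    · rw [Finset.sum_const, nsmul_eq_mul, ← mul_assoc, ENNReal.inv_mul_cancel, one_mul]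
      · simpa using (hK n).ne_empty
      · simp
    · intro k hk
      rw [lintegral_indicator_one (hms k)]
      exact hμ k (Nat.pos_of_ne_zero fun h => hK0 n (h ▸ hk))
  have hF := limsup_lintegral_le (μ := μ) (f := f) (fun _ => 1) hfm
    (fun n => Filter.Eventually.of_forall (hf1 n)) (by simp)
  simp only [hint, limsup_const] at hF
  have hfin : ∫⁻ x, limsup (fun n => f n x) atTop ∂μ ≠ ⊤ := by
    refine ne_top_of_le_ne_top (b := ∫⁻ x, 1 ∂μ) (by simp) (lintegral_mono fun x => ?_)
    exact limsup_le_of_le (h := Filter.Eventually.of_forall fun n => hf1 n x)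
  obtain ⟨x, hxZ, hx⟩ := exists_notMem_null_lintegral_le hfin hZ
  refine ⟨x, hxZ, ?_⟩
  have hx2 := hF.trans hx
  by_contra hcon
  rw [not_le] at hcon
  obtain ⟨c, hc1, hc2⟩ := exists_between hcon
  have hev := eventually_lt_of_limsup_lt hc1 (isBoundedUnder_of ⟨1, fun n => frac_le_one _ _⟩)
  have : limsup (fun n => f n x) atTop ≤ ENNReal.ofReal c := by
    refine limsup_le_of_le (h := ?_)
    filter_upwards [hev] with n hn
    rw [hfv]
    exact ENNReal.ofReal_le_ofReal hn.le
  have h3 := hx2.trans this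
  rw [show (1 / 2 : ENNReal) = ENNReal.ofReal (1 / 2) by
    rw [ENNReal.ofReal_div_of_pos (by norm_num)]; simp] at h3
  have := (ENNReal.ofReal_le_ofReal_iff' ).1 h3
  rcases this with h | h <;> linarith

/-- Let `A ⊆ ℕ` be a classical normal set and `(K n)` a Følner sequence in `(ℕ,×)`.
Then there is a set `E` of positive integers with upper `(K n)`-density at least `1/2`
such that for every nonempty finite subset `{n_1,…,n_k} ⊆ E`, the set
`A/n_1 ∩ … ∩ A/n_k = {m : n_i * m ∈ A for all i}` has positive upper density in `(ℕ,+)`. -/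
theorem exists_set_intersections_positive_upper_density
    (A : Set ℕ) (hA : ClassicalNormalSet A)
    (K : ℕ → Finset ℕ) (hK : MulFolner K) :
    ∃ E : Set ℕ, (∀ m ∈ E, 0 < m) ∧ (1 / 2 : ℝ) ≤ upperDensityAlong K E ∧
      ∀ s : Finset ℕ, s.Nonempty → ↑s ⊆ E →
        0 < upperDensity {m : ℕ | ∀ i ∈ s, i * m ∈ A} := by
  classical
  obtain ⟨hKne, hK0, -⟩ := hK
  let T : ℕ → (ℕ → Bool) := fun m n => decide (n * m ∈ A)
  obtain ⟨p, μ, hp, hpt, hlim⟩ := exists_limit_measure T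
  have hcl : ∀ n, IsClopen {x : ℕ → Bool | x n = true} := fun n =>
    (isClopen_discrete ({true} : Set Bool)).preimage (continuous_apply n)
  have hhalf : ∀ n, 0 < n → (μ : MeasureTheory.Measure (ℕ → Bool)) {x | x n = true} = 1 / 2 := by
    intro n hn
    have h1 := hlim _ (hcl n)
    have h2 := (density_div A hA n hn).mono_left hpt
    have h3 : ((μ {x : ℕ → Bool | x n = true} : NNReal) : ℝ) = 1 / 2 := by
      refine tendsto_nhds_unique h1 (h2.congr fun N => ?_)
      simp [T]
    have h4 : μ {x : ℕ → Bool | x n = true} = (1 / 2 : NNReal) := by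
      apply NNReal.eq; rw [h3]; simp
    rw [← MeasureTheory.ProbabilityMeasure.ennreal_coeFn_eq_coeFn_toMeasure, h4]
    simp
  let C : Finset ℕ → Set (ℕ → Bool) := fun s => ⋂ i ∈ s, {x | x i = true}
  have hC : ∀ s, IsClopen (C s) := fun s => isClopen_biInter_finset fun i _ => hcl i
  let Z : Set (ℕ → Bool) :=
    ⋃ s : {s : Finset ℕ // (μ : MeasureTheory.Measure (ℕ → Bool)) (C s) = 0}, C s
  have hZ : (μ : MeasureTheory.Measure (ℕ → Bool)) Z = 0 :=
    MeasureTheory.measure_iUnion_null fun s => s.2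
  obtain ⟨x, hxZ, hx⟩ := exists_good_point (μ : MeasureTheory.Measure (ℕ → Bool)) hhalf K hKne hK0
    Z hZ
  refine ⟨{n | 0 < n ∧ x n = true}, fun m hm => hm.1, ?_, ?_⟩
  · refine hx.trans_eq ?_
    unfold upperDensityAlong
    congr 1
    funext n
    congr 2
    refine congrArg Finset.card ?_
    ext k
    simp only [Finset.mem_filter, Set.mem_ofPred_eq]
    refine and_congr_right fun hk => ?_
    have : 0 < k := Nat.pos_of_ne_zero fun h => hK0 n (h ▸ hk)
    simp [this]
  · intro s _ hs
    have hxC : x ∈ C s := by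
      simp only [C, Set.mem_iInter]
      exact fun i hi => (hs hi).2
    have hne : (μ : MeasureTheory.Measure (ℕ → Bool)) (C s) ≠ 0 := fun h =>
      hxZ (Set.mem_iUnion.2 ⟨⟨s, h⟩, hxC⟩)
    have hpos : (0 : ℝ) < ((μ (C s) : NNReal) : ℝ) := by
      rw [NNReal.coe_pos, pos_iff_ne_zero]
      intro h
      apply hne
      rw [← MeasureTheory.ProbabilityMeasure.ennreal_coeFn_eq_coeFn_toMeasure, h]
      simp
    refine hpos.trans_le ?_
    unfold upperDensity
    refine le_limsup_frac hpt _ (fun N => ?_) ((hlim _ (hC s)).congr fun N => ?_)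
    · simpa using frac_le_one (Finset.Icc 1 N) (· ∈ {m : ℕ | ∀ i ∈ s, i * m ∈ A})
    · congr 2
      refine congrArg Finset.card ?_
      ext m
      simp [C, T]
end

section
/- For every Følner sequence (F_n) in (ℕ,+) there exists an (F_n)-normal Liouville number: there exist a Liouville number x ∈ (0,1) and a function a : ℕ → {0,1} such that x = ∑_{n=1}^∞ a(n)·2^{−n} and a is (F_n)-normal in (ℕ,+). -/
open Filter

/- `(F n)` is a Følner sequence in `(ℕ,+)`: nonempty finite sets with
`|F n ∩ (F n − k)| / |F n| → 1` for all `k`, where `F − k = {m : m + k ∈ F}`. -/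
def AddFolner (F : ℕ → Finset ℕ) : Prop :=
  (∀ n, (F n).Nonempty) ∧
  ∀ k : ℕ, Tendsto
    (fun n => (((F n).filter (fun m => m + k ∈ F n)).card : ℝ) / (F n).card)
    atTop (nhds 1)

/- `x : ℕ → {0,1}` is `(F n)`-normal in `(ℕ,+)`. -/
def AddNormalFun (F : ℕ → Finset ℕ) (x : ℕ → Bool) : Prop :=
  ∀ K : Finset ℕ, K.Nonempty → (∀ k ∈ K, 0 < k) → ∀ B : ℕ → Bool,
    Tendsto
      (fun n => (((F n).filter (fun m => ∀ k ∈ K, x (k + m) = B k)).card : ℝ) / (F n).card)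
      atTop (nhds ((1 / 2 : ℝ) ^ K.card))

def uuDigit (s m : ℕ) : Bool := Nat.testBit (m / s) (m % s)

lemma count_bits (j : ℕ) (B : ℕ → Bool) (K : Finset ℕ) (hK : ∀ k ∈ K, k < j) :
    ((Finset.range (2 ^ j)).filter (fun i => ∀ k ∈ K, Nat.testBit i k = B k)).card * 2 ^ K.card
      = 2 ^ j := by
  induction K using Finset.induction_on with
  | empty => simp
  | insert k K hk ih =>
    have ih' := ih (fun k' h => hK k' (Finset.mem_insert_of_mem h))
    have hkj := hK k (Finset.mem_insert_self _ _)
    rw [Finset.card_insert_of_notMem hk]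
    set S := (Finset.range (2 ^ j)).filter (fun i => ∀ k ∈ K, Nat.testBit i k = B k) with hS
    have h1 : (Finset.range (2 ^ j)).filter (fun i => ∀ k' ∈ insert k K, Nat.testBit i k' = B k')
        = S.filter (fun i => Nat.testBit i k = B k) := by
      ext i
      simp only [hS, Finset.mem_filter, Finset.mem_insert, forall_eq_or_imp]
      tauto
    rw [h1]
    have h2 := Finset.card_filter_add_card_filter_not (s := S) (fun i => Nat.testBit i k = B k)
    have h3 : (S.filter (fun i => Nat.testBit i k = B k)).card
        = (S.filter (fun i => ¬ Nat.testBit i k = B k)).card := by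
      apply Finset.card_nbij' (fun i => i ^^^ 2 ^ k) (fun i => i ^^^ 2 ^ k)
      · intro i hi
        simp only [hS, Finset.coe_filter, Finset.mem_filter, Finset.mem_range, Set.mem_ofPred_eq] at hi ⊢
        refine ⟨⟨Nat.xor_lt_two_pow hi.1.1 (Nat.pow_lt_pow_right (by norm_num) hkj), ?_⟩, ?_⟩
        · intro k' hk'
          rw [Nat.testBit_xor, Nat.testBit_two_pow]
          have : k ≠ k' := by rintro rfl; exact hk hk'
          simp [this, hi.1.2 k' hk']
        · rw [Nat.testBit_xor, Nat.testBit_two_pow, hi.2]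
          simp
      · intro i hi
        simp only [hS, Finset.coe_filter, Finset.mem_filter, Finset.mem_range, Set.mem_ofPred_eq] at hi ⊢
        refine ⟨⟨Nat.xor_lt_two_pow hi.1.1 (Nat.pow_lt_pow_right (by norm_num) hkj), ?_⟩, ?_⟩
        · intro k' hk'
          rw [Nat.testBit_xor, Nat.testBit_two_pow]
          have : k ≠ k' := by rintro rfl; exact hk hk'
          simp [this, hi.1.2 k' hk']
        · rw [Nat.testBit_xor, Nat.testBit_two_pow]
          have := hi.2
          revert this
          cases Nat.testBit i k <;> cases B k <;> simp
      · intro i hi; simp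
      · intro i hi; simp
    rw [← h2, ← h3] at ih'
    rw [pow_succ]
    linarith

lemma sum_range_mul_aux (f : ℕ → ℝ) (j n : ℕ) :
    ∑ m ∈ Finset.range (j * n), f m
      = ∑ r ∈ Finset.range j, ∑ i ∈ Finset.range n, f (j * i + r) := by
  rw [Finset.sum_comm]
  induction n with
  | zero => simp
  | succ n ih => rw [Finset.sum_range_succ, ← ih, Nat.mul_succ, Finset.sum_range_add]

lemma periodic_sum_shift (f : ℕ → ℝ) (p : ℕ) (hf : ∀ m, f (m + p) = f m) (m : ℕ) :
    ∑ i ∈ Finset.range p, f (m + i) = ∑ i ∈ Finset.range p, f i := by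
  induction m with
  | zero => simp
  | succ m ih =>
    rw [← ih]
    have h1 := Finset.sum_range_succ (fun i => f (m + i)) p
    have h2 := Finset.sum_range_succ' (fun i => f (m + i)) p
    have h3 : ∀ i, f (m + (i + 1)) = f (m + 1 + i) := fun i => by congr 1; ring
    simp only [h3, hf, add_zero] at h1 h2
    linarith

lemma periodic_sum_mul (f : ℕ → ℝ) (p c : ℕ) (hf : ∀ m, f (m + p) = f m) (m : ℕ) :
    ∑ i ∈ Finset.range (p * c), f (m + i) = c * ∑ i ∈ Finset.range p, f i := by
  induction c with
  | zero => simp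
  | succ c ih =>
    rw [Nat.mul_succ, Finset.sum_range_add, ih]
    have := periodic_sum_shift f p hf (m + p * c)
    simp only [add_assoc] at this ⊢
    rw [this]; push_cast; ring

lemma uuDigit_periodic (j m : ℕ) (hj : 0 < j) : uuDigit j (m + j * 2 ^ j) = uuDigit j m := by
  unfold uuDigit
  rw [Nat.add_mul_mod_self_left, Nat.add_mul_div_left _ _ hj, add_comm,
    Nat.testBit_two_pow_add_gt (Nat.mod_lt _ hj)]

noncomputable def devFun (x : ℕ → Bool) (K : Finset ℕ) (B : ℕ → Bool) (m : ℕ) : ℝ :=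
  (if ∀ k ∈ K, x (k + m) = B k then 1 else 0) - (1 / 2 : ℝ) ^ K.card

lemma abs_devFun_le (x : ℕ → Bool) (K : Finset ℕ) (B : ℕ → Bool) (m : ℕ) :
    |devFun x K B m| ≤ 1 := by
  unfold devFun
  have h1 : (0 : ℝ) ≤ (1 / 2 : ℝ) ^ K.card := by positivity
  have h2 : (1 / 2 : ℝ) ^ K.card ≤ 1 := pow_le_one₀ (by norm_num) (by norm_num)
  rw [abs_le]
  split_ifs <;> constructor <;> linarith

lemma uu_period_sum (j t : ℕ) (hj : 0 < j) (K : Finset ℕ) (hK : ∀ k ∈ K, k ≤ t) (B : ℕ → Bool) :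
    |∑ m ∈ Finset.range (j * 2 ^ j), devFun (uuDigit j) K B m| ≤ t * 2 ^ j := by
  rw [sum_range_mul_aux]
  have hz : ∀ r, r + t < j → ∑ i ∈ Finset.range (2 ^ j), devFun (uuDigit j) K B (j * i + r) = 0 := by
    intro r hr
    have h0 : ∀ i, devFun (uuDigit j) K B (j * i + r)
        = (if ∀ k ∈ K, Nat.testBit i (k + r) = B k then (1 : ℝ) else 0) - (1 / 2 : ℝ) ^ K.card := by
      intro i
      unfold devFun
      congr 1
      have : ∀ k ∈ K, uuDigit j (k + (j * i + r)) = Nat.testBit i (k + r) := by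
        intro k hk
        have hlt : k + r < j := by have := hK k hk; omega
        unfold uuDigit
        have e : k + (j * i + r) = (k + r) + j * i := by ring
        rw [e, Nat.add_mul_mod_self_left, Nat.add_mul_div_left _ _ hj, Nat.div_eq_of_lt hlt,
          Nat.mod_eq_of_lt hlt, zero_add]
      have : (∀ k ∈ K, uuDigit j (k + (j * i + r)) = B k) ↔ (∀ k ∈ K, Nat.testBit i (k + r) = B k) :=
        forall₂_congr (fun k hk => by rw [this k hk])
      simp only [this]
    simp only [h0, Finset.sum_sub_distrib, Finset.sum_const, Finset.card_range]
    rw [Finset.sum_boole]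
    have hc := count_bits j (fun k => B (k - r)) (K.map (addRightEmbedding r)) (by
      intro k hk
      simp only [Finset.mem_map, addRightEmbedding_apply] at hk
      obtain ⟨a, ha, rfl⟩ := hk
      have := hK a ha; omega)
    simp only [Finset.card_map, Finset.forall_mem_map, addRightEmbedding_apply,
      Nat.add_sub_cancel] at hc
    have hc' : (((Finset.range (2 ^ j)).filter
        (fun i => ∀ k ∈ K, Nat.testBit i (k + r) = B k)).card : ℝ) * 2 ^ K.card = 2 ^ j := by
      exact_mod_cast hc
    rw [nsmul_eq_mul]
    push_cast
    rw [← hc', mul_assoc, ← mul_pow]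
    norm_num
  calc |∑ r ∈ Finset.range j, ∑ i ∈ Finset.range (2 ^ j), devFun (uuDigit j) K B (j * i + r)|
      ≤ ∑ r ∈ Finset.range j, |∑ i ∈ Finset.range (2 ^ j), devFun (uuDigit j) K B (j * i + r)| :=
        Finset.abs_sum_le_sum_abs _ _
    _ ≤ ∑ r ∈ Finset.range j, (if r + t < j then (0 : ℝ) else 2 ^ j) := by
        apply Finset.sum_le_sum
        intro r _
        split_ifs with h
        · rw [hz r h]; simp
        · refine (Finset.abs_sum_le_sum_abs _ _).trans ?_
          refine (Finset.sum_le_sum (fun i _ => abs_devFun_le _ K B (j * i + r))).trans ?_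
          simp
    _ = ((Finset.range j).filter (fun r => ¬ r + t < j)).card * (2 : ℝ) ^ j := by
        rw [← Finset.sum_filter_not_add_sum_filter (Finset.range j) (fun r => r + t < j)]
        rw [Finset.sum_congr rfl (g := fun _ => (2 : ℝ) ^ j), Finset.sum_congr (s₁ := Finset.filter (fun r => r + t < j) _) rfl (g := fun _ => (0 : ℝ))]
        · simp
        · intro x hx; simp at hx; simp [hx.2]
        · intro x hx; simp only [Finset.mem_filter] at hx; rw [if_neg hx.2]
    _ ≤ t * 2 ^ j := by
        gcongr
        calc _ ≤ (Finset.Ico (j - t) j).card := by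
              apply Finset.card_le_card
              intro r hr
              simp at hr ⊢
              omega
          _ ≤ t := by rw [Nat.card_Ico]; omega

lemma window_bound (a : ℕ → Bool) (j t L m : ℕ) (hj : 0 < j) (hL : j * 2 ^ j ∣ L)
    (K : Finset ℕ) (hK : ∀ k ∈ K, k ≤ t) (B : ℕ → Bool)
    (ha : ∀ i, m ≤ i → i < m + L + t → a i = uuDigit j i) :
    |∑ i ∈ Finset.range L, devFun a K B (m + i)| ≤ L * t / j := by
  have h1 : ∑ i ∈ Finset.range L, devFun a K B (m + i)
      = ∑ i ∈ Finset.range L, devFun (uuDigit j) K B (m + i) := by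
    apply Finset.sum_congr rfl
    intro i hi
    have hi' := Finset.mem_range.1 hi
    unfold devFun
    congr 1
    have : (∀ k ∈ K, a (k + (m + i)) = B k) ↔ (∀ k ∈ K, uuDigit j (k + (m + i)) = B k) :=
      forall₂_congr (fun k hk => by
        rw [ha]
        · omega
        · have := hK k hk; omega)
    simp only [this]
  rw [h1]
  obtain ⟨c, rfl⟩ := hL
  rw [periodic_sum_mul (devFun (uuDigit j) K B) (j * 2 ^ j) c]
  · rw [abs_mul, Nat.abs_cast]
    have := uu_period_sum j t hj K hK B
    have hj' : (0 : ℝ) < j := by exact_mod_cast hj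
    calc (c : ℝ) * _ ≤ c * (t * 2 ^ j) := by gcongr
      _ = _ := by push_cast; field_simp
  · intro m
    unfold devFun
    simp only [← add_assoc, uuDigit_periodic j _ hj]

lemma folner_card_large (F : ℕ → Finset ℕ) (hF : AddFolner F) (C : ℕ) :
    ∀ᶠ n in atTop, C ≤ (F n).card := by
  have h := hF.2 1
  have hlt : (1 - 1 / ((C : ℝ) + 1)) < 1 := by
    have : (0 : ℝ) < 1 / ((C : ℝ) + 1) := by positivity
    linarith
  filter_upwards [h.eventually_const_lt hlt] with n hn
  have hne := hF.1 n
  have hpos : (0 : ℝ) < (F n).card := by exact_mod_cast hne.card_pos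
  have hcard : ((F n).filter (fun m => m + 1 ∈ F n)).card < (F n).card := by
    apply Finset.card_lt_card
    refine Finset.filter_ssubset.2 ⟨(F n).max' hne, Finset.max'_mem _ _, ?_⟩
    intro hm
    have := Finset.le_max' _ _ hm
    omega
  have hcard' : (((F n).filter (fun m => m + 1 ∈ F n)).card : ℝ) + 1 ≤ (F n).card := by
    exact_mod_cast hcard
  rw [lt_div_iff₀ hpos] at hn
  have hC : (0 : ℝ) < (C : ℝ) + 1 := by positivity
  have h3 : (1 : ℝ) < 1 / ((C : ℝ) + 1) * (F n).card := by linarith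
  rw [div_mul_eq_mul_div, one_mul, lt_div_iff₀ hC, one_mul] at h3
  have : (C : ℝ) ≤ (F n).card := by linarith
  exact_mod_cast this

lemma stage_exists (F : ℕ → Finset ℕ) (hF : AddFolner F) (k L C : ℕ) :
    ∃ N, k ≤ N ∧ ∀ n, N ≤ n → C ≤ (F n).card ∧ ∀ i < L,
      (1 - 1 / ((k : ℝ) + 1)) * (F n).card ≤ ((F n).filter (fun m => m + i ∈ F n)).card := by
  have hlt : (1 - 1 / ((k : ℝ) + 1)) < 1 := by
    have : (0 : ℝ) < 1 / ((k : ℝ) + 1) := by positivity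
    linarith
  have h1 : ∀ᶠ n in atTop, ∀ i ∈ Finset.range L,
      (1 - 1 / ((k : ℝ) + 1)) * (F n).card ≤ ((F n).filter (fun m => m + i ∈ F n)).card := by
    rw [Filter.eventually_all_finset]
    intro i _
    filter_upwards [(hF.2 i).eventually_const_lt hlt] with n hn
    have hpos : (0 : ℝ) < (F n).card := by exact_mod_cast (hF.1 n).card_pos
    rw [lt_div_iff₀ hpos] at hn
    exact hn.le
  obtain ⟨N, hN⟩ := Filter.eventually_atTop.1 ((folner_card_large F hF C).and h1)
  refine ⟨max k N, le_max_left _ _, fun n hn => ?_⟩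
  have := hN n (le_of_max_le_right hn)
  exact ⟨this.1, fun i hi => this.2 i (Finset.mem_range.2 hi)⟩

lemma abs_sum_le_card (g : ℕ → ℝ) (hg : ∀ m, |g m| ≤ 1) (S : Finset ℕ) :
    |∑ m ∈ S, g m| ≤ S.card := by
  refine (Finset.abs_sum_le_sum_abs _ _).trans ?_
  refine (Finset.sum_le_sum (fun i _ => hg i)).trans ?_
  simp

lemma shift_diff (g : ℕ → ℝ) (hg : ∀ m, |g m| ≤ 1) (S : Finset ℕ) (i : ℕ) :
    |∑ m ∈ S, g m - ∑ m ∈ S, g (m + i)|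
      ≤ 2 * ((S.card : ℝ) - (S.filter (fun m => m + i ∈ S)).card) := by
  set G := S.filter (fun m => m + i ∈ S) with hG
  have hGS : G ⊆ S := Finset.filter_subset _ _
  set M := G.map (addRightEmbedding i) with hM
  have hMS : M ⊆ S := by
    intro x hx
    simp only [hM, hG, Finset.mem_map, Finset.mem_filter, addRightEmbedding_apply] at hx
    obtain ⟨a, ha, rfl⟩ := hx
    exact ha.2
  have e1 := Finset.sum_sdiff (f := g) hMS
  have e2 := Finset.sum_sdiff (f := fun m => g (m + i)) hGS
  have e3 : ∑ m ∈ M, g m = ∑ m ∈ G, g (m + i) := by simp [hM]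
  have b1 := abs_sum_le_card g hg (S \ M)
  have b2 := abs_sum_le_card (fun m => g (m + i)) (fun m => hg _) (S \ G)
  have c1 : ((S \ M).card : ℝ) = S.card - G.card := by
    rw [Finset.cast_card_sdiff hMS]; simp [hM]
  have c2 : ((S \ G).card : ℝ) = S.card - G.card := by
    rw [Finset.cast_card_sdiff hGS]
  rw [c1] at b1
  rw [c2] at b2
  have : ∑ m ∈ S, g m - ∑ m ∈ S, g (m + i)
      = ∑ m ∈ S \ M, g m - ∑ m ∈ S \ G, g (m + i) := by
    linarith
  rw [this]
  refine (abs_sub _ _).trans ?_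
  linarith

/-- The core averaging estimate. -/
lemma stage_bound (g : ℕ → ℝ) (hg : ∀ m, |g m| ≤ 1) (S : Finset ℕ) (L : ℕ) (hL : 0 < L)
    (δ τ : ℝ) (hτ : 0 ≤ τ) (bad : Finset ℕ)
    (hinv : ∀ i < L, (1 - δ) * S.card ≤ (S.filter (fun m => m + i ∈ S)).card)
    (hgood : ∀ m ∈ S, m ∉ bad → |∑ i ∈ Finset.range L, g (m + i)| ≤ L * τ) :
    |∑ m ∈ S, g m| ≤ (2 * δ + τ) * S.card + bad.card := by
  have hL' : (0 : ℝ) < L := by exact_mod_cast hL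
  have h1 : |∑ i ∈ Finset.range L, (∑ m ∈ S, g m - ∑ m ∈ S, g (m + i))|
      ≤ L * (2 * δ * S.card) := by
    refine (Finset.abs_sum_le_sum_abs _ _).trans ?_
    refine (Finset.sum_le_sum (g := fun _ => 2 * δ * S.card) ?_).trans ?_
    · intro i hi
      have := shift_diff g hg S i
      have := hinv i (Finset.mem_range.1 hi)
      linarith
    · simp
  have h2 : |∑ m ∈ S, ∑ i ∈ Finset.range L, g (m + i)| ≤ L * (τ * S.card + bad.card) := by
    refine (Finset.abs_sum_le_sum_abs _ _).trans ?_
    refine (Finset.sum_le_sum (g := fun m => L * τ + if m ∈ bad then (L : ℝ) else 0) ?_).trans ?_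
    · intro m hm
      split_ifs with hb
      · have := abs_sum_le_card (fun i => g (m + i)) (fun i => hg _) (Finset.range L)
        rw [Finset.card_range] at this
        have : 0 ≤ L * τ := by positivity
        linarith
      · have := hgood m hm hb
        linarith
    · rw [Finset.sum_add_distrib, ← Finset.sum_filter]
      simp only [Finset.sum_const, nsmul_eq_mul]
      have : ((S.filter (fun m => m ∈ bad)).card : ℝ) ≤ bad.card := by
        exact_mod_cast Finset.card_le_card (fun x hx => (Finset.mem_filter.1 hx).2)
      nlinarith
  rw [Finset.sum_sub_distrib] at h1
  rw [Finset.sum_comm] at h2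
  simp only [Finset.sum_const, Finset.card_range, nsmul_eq_mul] at h1
  have h3 : L * |∑ m ∈ S, g m| ≤ L * ((2 * δ + τ) * S.card + bad.card) := by
    rw [← Nat.abs_cast L, ← abs_mul, Nat.abs_cast]
    rw [abs_le] at h1 h2 ⊢
    constructor <;> linarith
  exact le_of_mul_le_mul_left h3 hL'

noncomputable def binTail (a : ℕ → Bool) (j : ℕ) : ℝ :=
  ∑' n : ℕ, (if a (n + 1 + j) then (1 : ℝ) / 2 ^ (n + 1) else 0)

lemma geo_half_hasSum : HasSum (fun n : ℕ => (1 : ℝ) / 2 ^ (n + 1)) 1 := by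
  have := hasSum_geometric_two.mul_left (1 / 2 : ℝ)
  have e : (fun n : ℕ => (1 : ℝ) / 2 ^ (n + 1)) = fun i => 1 / 2 * (1 / 2) ^ i := by
    funext n
    rw [pow_succ, one_div_pow]; field_simp
  rw [e]
  simpa using this

lemma binTail_summable (a : ℕ → Bool) (j : ℕ) :
    Summable (fun n : ℕ => (if a (n + 1 + j) then (1 : ℝ) / 2 ^ (n + 1) else 0)) := by
  refine Summable.of_nonneg_of_le (fun n => ?_) (fun n => ?_) geo_half_hasSum.summable
  · split_ifs <;> positivity
  · split_ifs
    · exact le_rfl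
    · positivity

lemma binTail_nonneg (a : ℕ → Bool) (j : ℕ) : 0 ≤ binTail a j :=
  tsum_nonneg (fun n => by split_ifs <;> positivity)

lemma binTail_le_one (a : ℕ → Bool) (j : ℕ) : binTail a j ≤ 1 := by
  rw [← geo_half_hasSum.tsum_eq]
  refine Summable.tsum_le_tsum (fun n => ?_) (binTail_summable a j) geo_half_hasSum.summable
  split_ifs
  · exact le_rfl
  · positivity

lemma binTail_rec (a : ℕ → Bool) (j : ℕ) :
    2 * binTail a j = (if a (j + 1) then 1 else 0) + binTail a (j + 1) := by
  have h := (binTail_summable a j).tsum_eq_zero_add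
  have h2 : ∑' n : ℕ, (if a (n + 1 + 1 + j) then (1 : ℝ) / 2 ^ (n + 1 + 1) else 0)
      = 1 / 2 * binTail a (j + 1) := by
    unfold binTail
    rw [← tsum_mul_left]
    refine tsum_congr (fun n => ?_)
    have : n + 1 + 1 + j = n + 1 + (j + 1) := by ring
    rw [this, pow_succ (2 : ℝ) (n + 1)]
    split_ifs
    · field_simp
    · simp
  rw [h2] at h
  unfold binTail at h ⊢
  rw [h, zero_add, add_comm 1 j]
  split_ifs <;> norm_num <;> ring

lemma binTail_int (a : ℕ → Bool) (j : ℕ) : ∃ z : ℤ, 2 ^ j * binTail a 0 = z + binTail a j := by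
  induction j with
  | zero => exact ⟨0, by simp⟩
  | succ j ih =>
    obtain ⟨z, hz⟩ := ih
    have := binTail_rec a j
    refine ⟨2 * z + (if a (j + 1) then 1 else 0), ?_⟩
    rw [pow_succ]
    push_cast
    linarith

lemma binTail_agree (a : ℕ → Bool) (j j' n : ℕ)
    (h : ∀ i < n, a (j + i + 1) = a (j' + i + 1)) :
    2 ^ n * (binTail a j - binTail a j') = binTail a (j + n) - binTail a (j' + n) := by
  induction n with
  | zero => simp
  | succ n ih =>
    have ih' := ih (fun i hi => h i (by omega))
    have h1 := binTail_rec a (j + n)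
    have h2 := binTail_rec a (j' + n)
    rw [h n (by omega)] at h1
    rw [pow_succ]
    simp only [← add_assoc]
    linarith

lemma binTail_zeros (a : ℕ → Bool) (j n : ℕ) (h : ∀ i < n, a (j + i + 1) = false) :
    2 ^ n * binTail a j = binTail a (j + n) := by
  induction n with
  | zero => simp
  | succ n ih =>
    have ih' := ih (fun i hi => h i (by omega))
    have h1 := binTail_rec a (j + n)
    rw [h n (by omega)] at h1
    simp at h1
    rw [pow_succ]
    simp only [← add_assoc]
    linarith

lemma binTail_eq_zero (a : ℕ → Bool) (j : ℕ) (h : binTail a j = 0) (i : ℕ) :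
    a (i + 1 + j) = false := by
  unfold binTail at h
  have h2 := (binTail_summable a j).hasSum
  rw [h] at h2
  rw [hasSum_zero_iff_of_nonneg (fun n => by split_ifs <;> simp)] at h2
  have := congrFun h2 i
  simpa using this

lemma normal_irrational (F : ℕ → Finset ℕ) (hF : AddFolner F) (a : ℕ → Bool)
    (ha : AddNormalFun F a) : Irrational (binTail a 0) := by
  rintro ⟨q, hq⟩
  have hd : (0 : ℝ) < q.den := by exact_mod_cast q.den_pos
  have hinteger : ∀ j, ∃ z : ℤ, (q.den : ℝ) * binTail a j = z := by
    intro j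
    obtain ⟨z, hz⟩ := binTail_int a j
    refine ⟨2 ^ j * q.num - q.den * z, ?_⟩
    have h1 : binTail a j = 2 ^ j * q - z := by rw [hq]; linarith
    have h2 : (q : ℝ) * q.den = q.num := by exact_mod_cast q.mul_den_eq_num
    rw [h1]; push_cast
    rw [← h2]; ring
  -- a long run of zeros
  obtain ⟨K0, hK0⟩ : ∃ K0 : Finset ℕ, K0 = Finset.Icc 1 (q.den + 1) := ⟨_, rfl⟩
  have hzero := ha K0 ⟨1, by simp [hK0]⟩ (by
    intro k hk; rw [hK0] at hk; exact (Finset.mem_Icc.1 hk).1) (fun _ => false)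
  obtain ⟨n, hn⟩ := (hzero.eventually_const_lt (show (0 : ℝ) < _ by positivity)).exists
  have hne : ((F n).filter (fun m => ∀ k ∈ K0, a (k + m) = false)).Nonempty := by
    rw [Finset.nonempty_iff_ne_empty]
    intro h0
    rw [h0] at hn
    simp at hn
  obtain ⟨m, hm⟩ := hne
  have hm2 := (Finset.mem_filter.1 hm).2
  have hz := binTail_zeros a m (q.den + 1) (by
    intro i hi
    have := hm2 (i + 1) (by rw [hK0, Finset.mem_Icc]; omega)
    rw [← this]; congr 1; ring)
  obtain ⟨z, hz2⟩ := hinteger m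
  have hle := binTail_le_one a (m + (q.den + 1))
  have hpow : (q.den : ℝ) < 2 ^ (q.den + 1) := by
    have : q.den + 1 < 2 ^ (q.den + 1) := Nat.lt_two_pow_self
    exact_mod_cast (by omega : q.den < 2 ^ (q.den + 1))
  have hnn := binTail_nonneg a m
  have hz3 : (z : ℝ) < 1 := by
    rw [← hz2]
    by_contra hcon
    push Not at hcon
    have : 0 < binTail a m := by
      rcases hnn.lt_or_eq with h | h
      · exact h
      · rw [← h] at hcon; simp at hcon; linarith
    nlinarith
  have hz4 : (0 : ℝ) ≤ z := by rw [← hz2]; positivity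
  have hz5 : z = 0 := by
    have a1 : z < 1 := by exact_mod_cast hz3
    have a2 : 0 ≤ z := by exact_mod_cast hz4
    omega
  rw [hz5] at hz2
  have hm0 : binTail a m = 0 := by
    simpa [hd.ne'] using hz2
  have hall := binTail_eq_zero a m hm0
  obtain ⟨K1, hK1⟩ : ∃ K1 : Finset ℕ, K1 = {1} := ⟨_, rfl⟩
  have hone := ha K1 ⟨1, by simp [hK1]⟩ (by simp [hK1]) (fun _ => true)
  have hgt := hone.eventually_const_lt (show (1 / 4 : ℝ) < (1 / 2) ^ K1.card by rw [hK1]; norm_num)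
  obtain ⟨n', hn1, hn2⟩ := (hgt.and (folner_card_large F hF (4 * m + 1))).exists
  have hcard : ((F n').filter (fun m => ∀ k ∈ K1, a (k + m) = true)).card ≤ m := by
    rw [← Finset.card_range m]
    apply Finset.card_le_card
    intro x hx
    have hx2 := (Finset.mem_filter.1 hx).2 1 (by simp [hK1])
    rw [Finset.mem_range]
    by_contra hlt
    have := hall (x - m)
    rw [show x - m + 1 + m = 1 + x by omega] at this
    rw [this] at hx2
    exact Bool.noConfusion hx2
  have hpos : (0 : ℝ) < (F n').card := by exact_mod_cast (hF.1 n').card_pos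
  rw [lt_div_iff₀ hpos] at hn1
  have c1 : (((F n').filter (fun m => ∀ k ∈ K1, a (k + m) = true)).card : ℝ) ≤ m := by
    exact_mod_cast hcard
  have c2 : 4 * (m : ℝ) + 1 ≤ (F n').card := by exact_mod_cast hn2
  linarith

def winLen (k : ℕ) : ℕ := Nat.factorial (k + 2) * 2 ^ (k + 2)

lemma winLen_pos (k : ℕ) : 0 < winLen k :=
  Nat.mul_pos (Nat.factorial_pos _) (by positivity)

lemma winLen_mono {k l : ℕ} (h : k ≤ l) : winLen k ≤ winLen l :=
  Nat.mul_le_mul (Nat.factorial_le (by omega)) (Nat.pow_le_pow_right (by norm_num) (by omega))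

lemma dvd_winLen (k j : ℕ) (hj : 0 < j) (h : j ≤ k + 2) : j * 2 ^ j ∣ winLen k :=
  Nat.mul_dvd_mul (Nat.dvd_factorial hj h) (pow_dvd_pow 2 h)

lemma exists_scales (F : ℕ → Finset ℕ) (hF : AddFolner F) :
    ∃ N H : ℕ → ℕ, (∀ k, k ≤ N k) ∧
      (∀ k n, N k ≤ n → (k + 1) * (H k + winLen k + k) ≤ (F n).card ∧ ∀ i < winLen k,
        (1 - 1 / ((k : ℝ) + 1)) * (F n).card ≤ ((F n).filter (fun m => m + i ∈ F n)).card) ∧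
      (∀ k, ∀ n < N k, ∀ x ∈ F n, x + winLen k + k < H (k + 1)) ∧
      (∀ k, (H k + (k + 1) * 2 ^ (k + 1)) * (k + 1) + 1 ≤ H (k + 1)) := by
  choose N hN1 hN2 using fun k h : ℕ =>
    stage_exists F hF k (winLen k) ((k + 1) * (h + winLen k + k))
  let G : ℕ → ℕ → ℕ := fun k h =>
    ((h + (k + 1) * 2 ^ (k + 1)) * (k + 1) + 1) +
      ∑ n ∈ Finset.range (N k h), ∑ x ∈ F n, (x + winLen k + k + 1)
  let H : ℕ → ℕ := fun k => Nat.rec 0 (fun k h => G k h) k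
  have hH : ∀ k, H (k + 1) = G k (H k) := fun k => rfl
  refine ⟨fun k => N k (H k), H, fun k => hN1 k (H k), fun k n hn => hN2 k (H k) n hn, ?_, ?_⟩
  · intro k n hn x hx
    rw [hH]
    have h1 : ∑ x ∈ F n, (x + winLen k + k + 1)
        ≤ ∑ n ∈ Finset.range (N k (H k)), ∑ x ∈ F n, (x + winLen k + k + 1) :=
      Finset.single_le_sum (f := fun n => ∑ x ∈ F n, (x + winLen k + k + 1))
        (fun _ _ => Nat.zero_le _) (Finset.mem_range.2 hn)
    have h2 : x + winLen k + k + 1 ≤ ∑ x ∈ F n, (x + winLen k + k + 1) :=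
      Finset.single_le_sum (f := fun x => x + winLen k + k + 1)
        (fun _ _ => Nat.zero_le _) hx
    simp only [G]
    omega
  · intro k
    rw [hH]
    exact Nat.le_add_right _ _

lemma exists_digits (H : ℕ → ℕ) (hH : StrictMono H) :
    ∃ a : ℕ → Bool, ∀ k m, H k ≤ m → m < H (k + 1) → a m = uuDigit (k + 1) m := by
  classical
  refine ⟨fun m => uuDigit (Nat.findGreatest (fun j => H j ≤ m) m + 1) m, ?_⟩
  intro k m h1 h2
  have : Nat.findGreatest (fun j => H j ≤ m) m = k := by
    rw [Nat.findGreatest_eq_iff]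
    refine ⟨(hH.le_apply).trans h1, fun _ => h1, fun j hj _ hc => ?_⟩
    have := hH.monotone (show k + 1 ≤ j from hj)
    omega
  simp only [this]

lemma digits_liouville (H : ℕ → ℕ)
    (hH : ∀ k, (H k + (k + 1) * 2 ^ (k + 1)) * (k + 1) + 1 ≤ H (k + 1)) (a : ℕ → Bool)
    (ha : ∀ k m, H k ≤ m → m < H (k + 1) → a m = uuDigit (k + 1) m)
    (hirr : Irrational (binTail a 0)) : Liouville (binTail a 0) := by
  intro k
  set p := (k + 1) * 2 ^ (k + 1) with hp
  have hp2 : 2 ≤ p := by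
    have : 2 ^ 1 ≤ 2 ^ (k + 1) := Nat.pow_le_pow_right (by norm_num) (by omega)
    nlinarith
  obtain ⟨z1, hz1⟩ := binTail_int a (H k)
  obtain ⟨z2, hz2⟩ := binTail_int a (H k + p)
  set M := (H k + p) * k with hM
  have hHk : H k + p + M + 1 ≤ H (k + 1) := by
    have := hH k
    rw [← hp, mul_add, mul_one, ← hM] at this
    omega
  have hag := binTail_agree a (H k + p) (H k) M (by
    intro i hi
    rw [ha k _ (by omega) (by omega), ha k _ (by omega) (by omega)]
    rw [show H k + p + i + 1 = H k + i + 1 + (k + 1) * 2 ^ (k + 1) by rw [← hp]; ring]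
    exact uuDigit_periodic _ _ (Nat.succ_pos k))
  set q : ℤ := 2 ^ (H k) * (2 ^ p - 1) with hq
  have hp4 : (4 : ℤ) ≤ 2 ^ p := by
    calc (4 : ℤ) = 2 ^ 2 := by norm_num
      _ ≤ 2 ^ p := pow_le_pow_right₀ (by norm_num) hp2
  have hH1 : (1 : ℤ) ≤ 2 ^ (H k) := one_le_pow₀ (by norm_num)
  have hq1 : 1 < q := by nlinarith
  have hqR : (1 : ℝ) < q := by exact_mod_cast hq1
  have hqle : (q : ℝ) ≤ 2 ^ (H k + p) := by
    have : q ≤ 2 ^ (H k + p) := by rw [hq, pow_add]; nlinarith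
    exact_mod_cast this
  refine ⟨z2 - z1, q, hq1, ?_, ?_⟩
  · intro h
    apply hirr
    refine ⟨((z2 - z1 : ℤ) : ℚ) / (q : ℚ), ?_⟩
    rw [h]; push_cast; rfl
  · have e1 : (q : ℝ) * binTail a 0 - (z2 - z1 : ℤ) = binTail a (H k + p) - binTail a (H k) := by
      rw [hq]; push_cast
      rw [pow_add] at hz2
      linarith
    have e2 : binTail a 0 - ((z2 - z1 : ℤ) : ℝ) / q
        = (binTail a (H k + p) - binTail a (H k)) / q := by
      rw [← e1]; field_simp
    rw [e2, abs_div, abs_of_pos (by linarith : (0 : ℝ) < q)]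
    have b1 : |binTail a (H k + p + M) - binTail a (H k + M)| ≤ 1 := by
      have := binTail_nonneg a (H k + p + M)
      have := binTail_nonneg a (H k + M)
      have := binTail_le_one a (H k + p + M)
      have := binTail_le_one a (H k + M)
      rw [abs_le]; constructor <;> linarith
    rw [← hag, abs_mul, abs_of_pos (by positivity : (0 : ℝ) < 2 ^ M)] at b1
    have hqk : (q : ℝ) ^ k ≤ 2 ^ M := by
      rw [hM, pow_mul]
      exact pow_le_pow_left₀ (by linarith) hqle k
    have hqkpos : (0 : ℝ) < (q : ℝ) ^ k := by positivity
    rw [div_lt_div_iff₀ (by linarith) hqkpos, one_mul]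
    have hab := abs_nonneg (binTail a (H k + p) - binTail a (H k))
    nlinarith

lemma digits_normal (F : ℕ → Finset ℕ) (hF : AddFolner F) (N H : ℕ → ℕ) (hN : ∀ k, k ≤ N k)
    (hinv : ∀ k n, N k ≤ n → (k + 1) * (H k + winLen k + k) ≤ (F n).card ∧ ∀ i < winLen k,
        (1 - 1 / ((k : ℝ) + 1)) * (F n).card ≤ ((F n).filter (fun m => m + i ∈ F n)).card)
    (hmax : ∀ k, ∀ n < N k, ∀ x ∈ F n, x + winLen k + k < H (k + 1)) (a : ℕ → Bool)
    (ha : ∀ k m, H k ≤ m → m < H (k + 1) → a m = uuDigit (k + 1) m) :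
    AddNormalFun F a := by
  intro K _ _ B
  obtain ⟨t, ht⟩ : ∃ t, ∀ k ∈ K, k ≤ t := ⟨K.sup id, fun k hk => Finset.le_sup (f := id) hk⟩
  rw [Metric.tendsto_atTop]
  intro ε hε
  obtain ⟨k1, hk1⟩ := exists_nat_gt (((t : ℝ) + 3) / ε)
  set k0 := max k1 t with hk0
  refine ⟨N k0, fun n hn => ?_⟩
  -- the stage of `n`
  obtain ⟨k, hk, hNk, hNk'⟩ : ∃ k, k0 ≤ k ∧ N k ≤ n ∧ n < N (k + 1) := by
    by_contra hcon
    push Not at hcon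
    have : ∀ d, N (k0 + d) ≤ n := by
      intro d
      induction d with
      | zero => exact hn
      | succ d ih => exact hcon (k0 + d) (by omega) ih
    have h1 := this (n + 1)
    have h2 := hN (k0 + (n + 1))
    omega
  obtain ⟨hcard, hin⟩ := hinv k n hNk
  have hkt : t ≤ k := (le_max_right _ _).trans hk
  have hkk : k1 ≤ k := (le_max_left _ _).trans hk
  have hk1pos : (0 : ℝ) < (k : ℝ) + 1 := by positivity
  have key := stage_bound (devFun a K B) (abs_devFun_le a K B) (F n) (winLen k) (winLen_pos k)
    (1 / ((k : ℝ) + 1)) (t / ((k : ℝ) + 1)) (by positivity)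
    (Finset.range (H k) ∪ Finset.Ico (H (k + 1) - (winLen k + k)) (H (k + 1))) hin (by
      intro m hm hb
      simp only [Finset.mem_union, Finset.mem_range, Finset.mem_Ico, not_or, not_and, not_lt] at hb
      obtain ⟨hb1, hb2⟩ := hb
      by_cases hlt : m < H (k + 1)
      · have hw := window_bound a (k + 1) t (winLen k) m (Nat.succ_pos k)
          (dvd_winLen k _ (Nat.succ_pos k) (by omega)) K ht B (by
            intro i h1 h2
            refine ha k i (by omega) ?_
            by_contra hc
            have := hb2 (by omega)
            omega)
        rw [mul_div_assoc] at hw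
        exact_mod_cast hw
      · have hmm := hmax (k + 1) n hNk' m hm
        have hwm := winLen_mono (show k ≤ k + 1 by omega)
        have hw := window_bound a (k + 2) t (winLen k) m (Nat.succ_pos _)
          (dvd_winLen k _ (Nat.succ_pos _) le_rfl) K ht B (by
            intro i h1 h2
            exact ha (k + 1) i (by omega) (by omega))
        rw [mul_div_assoc] at hw
        refine hw.trans ?_
        push_cast
        gcongr
        linarith)
  have hbad : (((Finset.range (H k) ∪
      Finset.Ico (H (k + 1) - (winLen k + k)) (H (k + 1))).card : ℕ) : ℝ)
      ≤ 1 / ((k : ℝ) + 1) * (F n).card := by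
    have h1 : (Finset.range (H k) ∪
        Finset.Ico (H (k + 1) - (winLen k + k)) (H (k + 1))).card ≤ H k + winLen k + k := by
      refine (Finset.card_union_le _ _).trans ?_
      rw [Finset.card_range, Nat.card_Ico]
      omega
    have h2 : (((Finset.range (H k) ∪
        Finset.Ico (H (k + 1) - (winLen k + k)) (H (k + 1))).card : ℕ) : ℝ)
        ≤ ((H k + winLen k + k : ℕ) : ℝ) := by exact_mod_cast h1
    have h3 : ((k : ℝ) + 1) * ((H k + winLen k + k : ℕ) : ℝ) ≤ (F n).card := by
      exact_mod_cast hcard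
    refine h2.trans ?_
    rw [div_mul_eq_mul_div, one_mul, le_div_iff₀ hk1pos]
    linarith
  have hpos : (0 : ℝ) < (F n).card := by exact_mod_cast (hF.1 n).card_pos
  have hsum : ∑ m ∈ F n, devFun a K B m
      = ((F n).filter (fun m => ∀ k ∈ K, a (k + m) = B k)).card
        - (F n).card * (1 / 2 : ℝ) ^ K.card := by
    unfold devFun
    rw [Finset.sum_sub_distrib, Finset.sum_boole]
    simp
  rw [hsum] at key
  rw [Real.dist_eq]
  have e : (((F n).filter (fun m => ∀ k ∈ K, a (k + m) = B k)).card : ℝ) / (F n).card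
      - (1 / 2 : ℝ) ^ K.card
      = (((F n).filter (fun m => ∀ k ∈ K, a (k + m) = B k)).card
        - (F n).card * (1 / 2 : ℝ) ^ K.card) / (F n).card := by
    field_simp
  rw [e, abs_div, abs_of_pos hpos, div_lt_iff₀ hpos]
  have hfin : ((t : ℝ) + 3) / ((k : ℝ) + 1) < ε := by
    rw [div_lt_iff₀ hε] at hk1
    rw [div_lt_iff₀ hk1pos]
    have : (k1 : ℝ) ≤ k := by exact_mod_cast hkk
    nlinarith
  calc _ ≤ _ := key
    _ ≤ (2 * (1 / ((k : ℝ) + 1)) + t / ((k : ℝ) + 1)) * (F n).card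
        + 1 / ((k : ℝ) + 1) * (F n).card := by gcongr
    _ = ((t : ℝ) + 3) / ((k : ℝ) + 1) * (F n).card := by ring
    _ < ε * (F n).card := by gcongr

/-- For every Følner sequence `(F n)` in `(ℕ,+)` there exists an `(F n)`-normal
Liouville number: a Liouville number `x ∈ (0,1)` whose binary digit sequence
`a : ℕ → {0,1}` (so `x = ∑_{n ≥ 1} a n · 2^{-n}`) is `(F n)`-normal in `(ℕ,+)`. -/
theorem exists_addNormal_liouville
    (F : ℕ → Finset ℕ) (hF : AddFolner F) :
    ∃ (x : ℝ) (a : ℕ → Bool), Liouville x ∧ x ∈ Set.Ioo (0 : ℝ) 1 ∧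
      x = ∑' n : ℕ, (if a (n + 1) then (1 : ℝ) / 2 ^ (n + 1) else 0) ∧
      AddNormalFun F a := by
  obtain ⟨N, H, hN, hinv, hmax, hgrow⟩ := exists_scales F hF
  have hmono : StrictMono H := strictMono_nat_of_lt_succ (fun k => by
    have h1 := hgrow k
    have h2 : H k * 1 ≤ (H k + (k + 1) * 2 ^ (k + 1)) * (k + 1) :=
      Nat.mul_le_mul (Nat.le_add_right _ _) (by omega)
    omega)
  obtain ⟨a, ha⟩ := exists_digits H hmono
  have hnormal := digits_normal F hF N H hN hinv hmax a ha
  have hirr := normal_irrational F hF a hnormal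
  refine ⟨binTail a 0, a, digits_liouville H hgrow a ha hirr, ⟨?_, ?_⟩, rfl, hnormal⟩
  · exact lt_of_le_of_ne (binTail_nonneg a 0) (fun h => hirr.ne_zero h.symm)
  · exact lt_of_le_of_ne (binTail_le_one a 0) hirr.ne_one
end

section
/- For every nice Følner sequence (F_n) in (ℕ,×) there exists an (F_n)-normal Liouville number: there exist a Liouville number x ∈ (0,1) and a function a : ℕ → {0,1} such that x = ∑_{n=1}^∞ a(n)·2^{−n} and a is (F_n)-normal in (ℕ,×). -/
open Filter

/- A nice Følner sequence in `(ℕ,×)`: `F n` is the set of positive divisors of `L n`,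
where `L n` is a proper divisor of `L (n+1)` and every positive integer divides `L n`
for all sufficiently large `n`. -/
def NiceFolner (F : ℕ → Finset ℕ) : Prop :=
  ∃ L : ℕ → ℕ, (∀ n, 0 < L n) ∧ (∀ n, L n ∣ L (n + 1)) ∧ (∀ n, L n ≠ L (n + 1)) ∧
    (∀ m : ℕ, 0 < m → ∀ᶠ n in atTop, m ∣ L n) ∧ (∀ n, F n = (L n).divisors)

/- `x : ℕ → {0,1}` is `(F n)`-normal in `(ℕ,×)`. -/
def MulNormalFun (F : ℕ → Finset ℕ) (x : ℕ → Bool) : Prop :=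
  ∀ K : Finset ℕ, K.Nonempty → (∀ k ∈ K, 0 < k) → ∀ B : ℕ → Bool,
    Tendsto
      (fun n => (((F n).filter (fun m => ∀ k ∈ K, x (k * m) = B k)).card : ℝ) / (F n).card)
      atTop (nhds ((1 / 2 : ℝ) ^ K.card))



open MeasureTheory ProbabilityTheory in
noncomputable def coin : Measure (ℕ → Bool) :=
  Measure.infinitePi (fun _ : ℕ => (PMF.uniformOfFintype Bool).toMeasure)

instance : MeasureTheory.IsProbabilityMeasure coin := by
  unfold coin; infer_instance

def sg (b : Bool) : ℝ := if b then 1 else -1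

noncomputable def chr (T : Finset ℕ) (ω : ℕ → Bool) : ℝ := ∏ t ∈ T, sg (ω t)

lemma sg_sq (b : Bool) : sg b * sg b = 1 := by cases b <;> simp [sg]

lemma chr_cases (T : Finset ℕ) (ω : ℕ → Bool) : chr T ω = 1 ∨ chr T ω = -1 := by
  have : chr T ω * chr T ω = 1 := by
    unfold chr; rw [← Finset.prod_mul_distrib]; simp [sg_sq]
  exact mul_self_eq_one_iff.1 this

lemma measurable_chr (T : Finset ℕ) : Measurable (chr T) := by
  unfold chr
  refine Finset.measurable_prod _ fun t _ => ?_
  exact (measurable_of_finite sg).comp (measurable_pi_apply t)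

open MeasureTheory ProbabilityTheory

lemma integrable_chr (T : Finset ℕ) : Integrable (chr T) coin := by
  refine Integrable.of_bound (C := 1) (measurable_chr T).aestronglyMeasurable (ae_of_all _ fun ω => ?_)
  rcases chr_cases T ω with h | h <;> simp [h]

lemma integral_chr (T : Finset ℕ) (hT : T.Nonempty) : ∫ ω, chr T ω ∂coin = 0 := by
  have hind : iIndepFun (fun (t : ℕ) (ω : ℕ → Bool) => sg (ω t)) coin :=
    iIndepFun_infinitePi (P := fun _ : ℕ => (PMF.uniformOfFintype Bool).toMeasure)
      (X := fun _ => sg) (fun _ => measurable_of_finite sg)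
  have h1 : iIndepFun (fun (t : T) (ω : ℕ → Bool) => sg (ω t)) coin :=
    hind.precomp Subtype.val_injective
  have hm : ∀ t : ℕ, Measurable (fun ω : ℕ → Bool => sg (ω t)) := fun t =>
    (measurable_of_finite sg).comp (measurable_pi_apply t)
  have h2 := h1.integral_fun_prod_eq_prod_integral (fun t => (hm t).aestronglyMeasurable)
  have h3 : ∀ t : ℕ, ∫ ω, sg (ω t) ∂coin = 0 := by
    intro t
    have := integral_map (μ := coin) (φ := fun ω : ℕ → Bool => ω t) (f := sg)
      (measurable_pi_apply t).aemeasurable (measurable_of_finite sg).aestronglyMeasurable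
    rw [← this]
    have e : coin.map (fun ω : ℕ → Bool => ω t) = (PMF.uniformOfFintype Bool).toMeasure :=
      Measure.infinitePi_map_eval _ t
    rw [e, PMF.integral_eq_sum]
    simp [sg]
  have h4 : ∫ ω, chr T ω ∂coin = ∫ ω, ∏ t : T, sg (ω t) ∂coin := by
    congr 1; ext ω; unfold chr; rw [← Finset.prod_coe_sort]
  rw [h4, h2]
  obtain ⟨t, ht⟩ := hT
  exact Finset.prod_eq_zero (Finset.mem_univ ⟨t, ht⟩) (h3 t)

lemma chr_mul (S T : Finset ℕ) (ω : ℕ → Bool) : chr S ω * chr T ω = chr (symmDiff S T) ω := by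
  have hS : chr S ω = chr (S \ T) ω * chr (S ∩ T) ω := by
    unfold chr
    rw [← Finset.prod_union (Finset.disjoint_sdiff_inter S T), Finset.sdiff_union_inter]
  have hT : chr T ω = chr (T \ S) ω * chr (S ∩ T) ω := by
    unfold chr
    rw [Finset.inter_comm, ← Finset.prod_union (Finset.disjoint_sdiff_inter T S), Finset.sdiff_union_inter]
  have hD : chr (symmDiff S T) ω = chr (S \ T) ω * chr (T \ S) ω := by
    unfold chr
    rw [← Finset.prod_union]
    · rfl
    · exact Finset.disjoint_left.2 (by simp; tauto)
  rw [hS, hT, hD]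
  rcases chr_cases (S ∩ T) ω with h | h <;> rw [h] <;> ring

def pos (T : Finset ℕ) : Set (ℕ → Bool) := {ω | chr T ω = 1}

lemma measurableSet_pos (T : Finset ℕ) : MeasurableSet (pos T) :=
  (measurable_chr T) (measurableSet_singleton 1)

lemma real_pos (T : Finset ℕ) (hT : T.Nonempty) : coin.real (pos T) = 1 / 2 := by
  rw [← integral_indicator_one (measurableSet_pos T)]
  have : (pos T).indicator (1 : (ℕ → Bool) → ℝ) = fun ω => 1/2 + 1/2 * chr T ω := by
    ext ω
    rcases chr_cases T ω with h | h <;> simp [Set.indicator, pos, h] <;> norm_num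
  rw [this, integral_add (integrable_const _) ((integrable_chr T).const_mul _),
    integral_const_mul, integral_chr T hT]
  simp

lemma real_pos_inter (S T : Finset ℕ) (hS : S.Nonempty) (hT : T.Nonempty) (h : S ≠ T) :
    coin.real (pos S ∩ pos T) = 1 / 4 := by
  rw [← integral_indicator_one ((measurableSet_pos S).inter (measurableSet_pos T))]
  have : (pos S ∩ pos T).indicator (1 : (ℕ → Bool) → ℝ) = fun ω => 1/4 + 1/4 * chr S ω
      + 1/4 * chr T ω + 1/4 * chr (symmDiff S T) ω := by
    ext ω
    rw [← chr_mul]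
    rcases chr_cases T ω with h | h <;> rcases chr_cases S ω with h' | h' <;>
      simp [Set.indicator, pos, h, h'] <;> norm_num
  have hD : (symmDiff S T).Nonempty := by
    rw [Finset.nonempty_iff_ne_empty]
    intro h0
    exact h (symmDiff_eq_bot.1 h0)
  have i0 : Integrable (fun _ : ℕ → Bool => (1/4 : ℝ)) coin := integrable_const _
  have i1 := (integrable_chr S).const_mul (1/4)
  have i2 := (integrable_chr T).const_mul (1/4)
  have i3 := (integrable_chr (symmDiff S T)).const_mul (1/4)
  have j1 : Integrable (fun ω => 1/4 + 1/4 * chr S ω) coin := i0.add i1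
  have j2 : Integrable (fun ω => 1/4 + 1/4 * chr S ω + 1/4 * chr T ω) coin := j1.add i2
  rw [this, integral_add j2 i3, integral_add j1 i2, integral_add i0 i1,
    integral_const_mul, integral_const_mul, integral_const_mul, integral_chr _ hS,
    integral_chr _ hT, integral_chr _ hD]
  simp

lemma chr_eq_ite (T : Finset ℕ) : chr T = fun ω => open Classical in if ω ∈ pos T then (1:ℝ) else -1 := by
  ext ω
  rcases chr_cases T ω with h | h <;> simp [pos, h]

lemma comap_chr_le (T : Finset ℕ) :
    MeasurableSpace.comap (chr T) inferInstance ≤ MeasurableSpace.generateFrom {pos T} := by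
  rw [← measurable_iff_comap_le, chr_eq_ite]
  refine Measurable.ite (m := MeasurableSpace.generateFrom {pos T}) ?_ measurable_const measurable_const
  exact MeasurableSpace.measurableSet_generateFrom rfl

lemma coin_pos (T : Finset ℕ) (hT : T.Nonempty) : coin (pos T) = ENNReal.ofReal (1/2) := by
  rw [← real_pos T hT]; simp [measureReal_def]

lemma indep_chr (S T : Finset ℕ) (hS : S.Nonempty) (hT : T.Nonempty) (h : S ≠ T) :
    IndepFun (chr S) (chr T) coin := by
  have : IndepSet (pos S) (pos T) coin := by
    rw [indepSet_iff_measure_inter_eq_mul (measurableSet_pos S) (measurableSet_pos T) coin]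
    rw [coin_pos S hS, coin_pos T hT, ← ENNReal.ofReal_mul (by norm_num)]
    have := real_pos_inter S T hS hT h
    rw [measureReal_def] at this
    rw [← ENNReal.ofReal_toReal (measure_ne_top coin (pos S ∩ pos T)), this]
    norm_num
  exact indep_of_indep_of_le_left (indep_of_indep_of_le_right this (comap_chr_le T)) (comap_chr_le S)

lemma identDistrib_chr (S T : Finset ℕ) (hS : S.Nonempty) (hT : T.Nonempty) :
    IdentDistrib (chr S) (chr T) coin coin := by
  refine ⟨(measurable_chr S).aemeasurable, (measurable_chr T).aemeasurable, ?_⟩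
  have key : ∀ T : Finset ℕ, T.Nonempty → ∀ s : Set ℝ, coin (chr T ⁻¹' s) =
      open Classical in (if (1:ℝ) ∈ s then (if (-1:ℝ) ∈ s then 1 else ENNReal.ofReal (1/2)) else
        (if (-1:ℝ) ∈ s then 1 - ENNReal.ofReal (1/2) else 0)) := by
    intro T hT s
    have hc := prob_compl_eq_one_sub (μ := coin) (measurableSet_pos T)
    rw [coin_pos T hT] at hc
    by_cases h1 : (1:ℝ) ∈ s <;> by_cases h2 : (-1:ℝ) ∈ s <;> simp only [h1, h2, if_true, if_false]
    · rw [← measure_univ (μ := coin)]; congr 1; ext ω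
      rcases chr_cases T ω with h | h <;> simp [h, h1, h2]
    · rw [← coin_pos T hT]; congr 1; ext ω
      rcases chr_cases T ω with h | h <;> simp [h, h1, h2, pos]; norm_num
    · rw [← hc]; congr 1; ext ω
      rcases chr_cases T ω with h | h <;> simp [h, h1, h2, pos]; norm_num
    · rw [← measure_empty (μ := coin)]; congr 1; ext ω
      rcases chr_cases T ω with h | h <;> simp [h, h1, h2]
  ext s hs
  rw [Measure.map_apply (measurable_chr S) hs, Measure.map_apply (measurable_chr T) hs,
    key S hS, key T hT]

lemma slln (T : ℕ → Finset ℕ) (hT : ∀ i, (T i).Nonempty) (hinj : Function.Injective T) :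
    ∀ᵐ ω ∂coin, Tendsto (fun n : ℕ => (∑ i ∈ Finset.range n, chr (T i) ω) / n) atTop (nhds 0) := by
  have := strong_law_ae_real (μ := coin) (fun i => chr (T i)) (integrable_chr _)
    (fun i j hij => indep_chr _ _ (hT i) (hT j) (fun h => hij (hinj h)))
    (fun i => identDistrib_chr _ _ (hT i) (hT 0))
  rwa [integral_chr _ (hT 0)] at this

/-- Enumeration of a strictly increasing sequence of finsets. -/
lemma exists_enum (F : ℕ → Finset ℕ) (hsub : ∀ n, F n ⊂ F (n + 1)) :
    ∃ e : ℕ → ℕ, Function.Injective e ∧ ∀ n, F n = (Finset.range (F n).card).image e := by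
  obtain ⟨l, l0, ls⟩ : ∃ l : ℕ → List ℕ, l 0 = (F 0).toList ∧
      ∀ n, l (n+1) = l n ++ (F (n+1) \ F n).toList :=
    ⟨fun n => Nat.rec (F 0).toList (fun n l => l ++ (F (n+1) \ F n).toList) n, rfl, fun _ => rfl⟩
  have lmem : ∀ n x, x ∈ l n ↔ x ∈ F n := by
    intro n
    induction n with
    | zero => intro x; simp [l0]
    | succ n ih =>
      intro x; rw [ls, List.mem_append, ih]; simp
      have := @(hsub n).1 x
      tauto
  have lnd : ∀ n, (l n).Nodup := by
    intro n
    induction n with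
    | zero => rw [l0]; exact Finset.nodup_toList _
    | succ n ih =>
      rw [ls]
      refine List.Nodup.append ih (Finset.nodup_toList _) ?_
      intro x hx hx'
      rw [lmem] at hx
      simp at hx'
      exact hx'.2 hx
  have lfin : ∀ n, (l n).toFinset = F n := by intro n; ext x; simp [lmem]
  have llen : ∀ n, (l n).length = (F n).card := by
    intro n; rw [← lfin n, List.toFinset_card_of_nodup (lnd n)]
  have lpre : ∀ n m, n ≤ m → l n <+: l m := by
    intro n m h
    induction h with
    | refl => exact List.prefix_refl _
    | step _ ih => exact ih.trans (by rw [ls]; exact List.prefix_append _ _)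
  have hcard : ∀ n, n ≤ (F n).card := by
    intro n
    induction n with
    | zero => simp
    | succ n ih => exact Nat.succ_le_of_lt (lt_of_le_of_lt ih (Finset.card_lt_card (hsub n)))
  have hl : ∀ i, i < (l (i+1)).length := by
    intro i; rw [llen]; exact hcard (i+1)
  have key : ∀ n i (h : i < (l n).length), (l (i+1))[i]'(hl i) = (l n)[i] := by
    intro n i h
    rcases le_total n (i+1) with h' | h'
    · exact ((lpre _ _ h').getElem h).symm
    · exact ((lpre _ _ h').getElem (hl i))
  refine ⟨fun i => (l (i+1))[i]'(hl i), ?_, ?_⟩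
  · intro i j hij
    have hi : i < (l (i+j+1)).length := by rw [llen]; have := hcard (i+j+1); omega
    have hj : j < (l (i+j+1)).length := by rw [llen]; have := hcard (i+j+1); omega
    simp only [key _ i hi, key _ j hj] at hij
    exact (lnd _).getElem_inj_iff.1 hij
  · intro n
    ext x
    rw [← lmem n, List.mem_iff_getElem]
    simp only [Finset.mem_image, Finset.mem_range, ← llen]
    constructor
    · rintro ⟨i, h, rfl⟩; exact ⟨i, h, key n i h⟩
    · rintro ⟨i, h, rfl⟩; exact ⟨i, h, (key n i h).symm⟩

/-- Existence of a sequence with vanishing correlations. -/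
lemma exists_uncorrelated (F : ℕ → Finset ℕ) (hsub : ∀ n, F n ⊂ F (n + 1)) (h0 : ∀ n, 0 ∉ F n) :
    ∃ b : ℕ → Bool, ∀ K : Finset ℕ, K.Nonempty → (∀ k ∈ K, 0 < k) →
      Tendsto (fun n => (∑ m ∈ F n, ∏ k ∈ K, sg (b (k * m))) / (F n).card) atTop (nhds 0) := by
  obtain ⟨e, einj, he⟩ := exists_enum F hsub
  have hcard : StrictMono (fun n => (F n).card) :=
    strictMono_nat_of_lt_succ fun n => Finset.card_lt_card (hsub n)
  have epos : ∀ i, 0 < e i := by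
    intro i
    have : e i ∈ F (i+1) := by
      rw [he (i+1)]
      refine Finset.mem_image_of_mem _ (Finset.mem_range.2 ?_)
      exact lt_of_lt_of_le (Nat.lt_succ_self i) (hcard.le_apply (x := i+1))
    exact Nat.pos_of_ne_zero fun h => h0 _ (h ▸ this)
  have main : ∀ᵐ ω ∂coin, ∀ K : Finset ℕ, K.Nonempty → (∀ k ∈ K, 0 < k) →
      Tendsto (fun n : ℕ => (∑ i ∈ Finset.range n, chr (K.image (fun k => k * e i)) ω) / n)
        atTop (nhds 0) := by
    rw [ae_all_iff]
    intro K
    by_cases hK : K.Nonempty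
    swap
    · exact ae_of_all _ fun _ h => absurd h hK
    by_cases hp : ∀ k ∈ K, 0 < k
    swap
    · exact ae_of_all _ fun _ _ h => absurd h hp
    have := slln (fun i => K.image (fun k => k * e i)) (fun i => hK.image _) ?_
    · filter_upwards [this] with ω h _ _ using h
    · intro i j hij
      apply einj
      have hs : ∀ i, ∑ x ∈ K.image (fun k => k * e i), x = (∑ k ∈ K, k) * e i := by
        intro i
        rw [Finset.sum_image, Finset.sum_mul]
        intro a _ b _ hab
        exact Nat.eq_of_mul_eq_mul_right (epos i) hab
      have h2 := hs i
      rw [show K.image (fun k => k * e i) = K.image (fun k => k * e j) from hij, hs j] at h2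
      have hpos : 0 < ∑ k ∈ K, k := Finset.sum_pos hp hK
      exact (Nat.eq_of_mul_eq_mul_left hpos h2).symm
  obtain ⟨b, hb⟩ := main.exists
  refine ⟨b, fun K hK hp => ?_⟩
  have := (hb K hK hp).comp hcard.tendsto_atTop
  refine this.congr fun n => ?_
  simp only [Function.comp]
  congr 1
  conv_rhs => rw [he n]
  rw [Finset.sum_image (fun _ _ _ _ h => einj h)]
  refine Finset.sum_congr rfl fun i _ => ?_
  unfold chr
  rw [Finset.prod_image]
  intro x _ y _ hxy
  exact Nat.eq_of_mul_eq_mul_right (epos i) hxy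

lemma cyl_eq (K : Finset ℕ) (B : ℕ → Bool) (b : ℕ → Bool) (m : ℕ) :
    (if ∀ k ∈ K, b (k * m) = B k then (1:ℝ) else 0) =
      (1/2) ^ K.card * ∑ T ∈ K.powerset, (∏ k ∈ T, sg (B k)) * ∏ k ∈ T, sg (b (k * m)) := by
  have h1 : ∀ k, (if b (k*m) = B k then (1:ℝ) else 0) = (1/2) * (1 + sg (B k) * sg (b (k*m))) := by
    intro k
    cases b (k*m) <;> cases B k <;> simp [sg] <;> norm_num
  have h2 : (if ∀ k ∈ K, b (k * m) = B k then (1:ℝ) else 0) =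
      ∏ k ∈ K, (if b (k*m) = B k then (1:ℝ) else 0) := by
    rw [Finset.prod_ite_zero]; simp
  rw [h2]
  simp_rw [h1]
  rw [Finset.prod_mul_distrib, Finset.prod_const, Finset.prod_one_add]
  simp_rw [Finset.prod_mul_distrib]

lemma normal_of_uncorrelated (F : ℕ → Finset ℕ) (hne : ∀ n, (F n).Nonempty) (b : ℕ → Bool)
    (hb : ∀ K : Finset ℕ, K.Nonempty → (∀ k ∈ K, 0 < k) →
      Tendsto (fun n => (∑ m ∈ F n, ∏ k ∈ K, sg (b (k * m))) / (F n).card) atTop (nhds 0))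
    (K : Finset ℕ) (hp : ∀ k ∈ K, 0 < k) (B : ℕ → Bool) :
    Tendsto
      (fun n => (((F n).filter (fun m => ∀ k ∈ K, b (k * m) = B k)).card : ℝ) / (F n).card)
      atTop (nhds ((1 / 2 : ℝ) ^ K.card)) := by
  have e : ∀ n, (((F n).filter (fun m => ∀ k ∈ K, b (k * m) = B k)).card : ℝ) / (F n).card =
      (1/2) ^ K.card * ∑ T ∈ K.powerset, (∏ k ∈ T, sg (B k)) *
        ((∑ m ∈ F n, ∏ k ∈ T, sg (b (k * m))) / (F n).card) := by
    intro n
    rw [Finset.card_filter]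
    push_cast
    simp_rw [cyl_eq]
    rw [← Finset.mul_sum, Finset.sum_comm, mul_div_assoc, Finset.sum_div]
    congr 1
    refine Finset.sum_congr rfl fun T _ => ?_
    rw [← Finset.mul_sum, mul_div_assoc]
  simp_rw [e]
  have lim : Tendsto (fun n => (1/2 : ℝ) ^ K.card * ∑ T ∈ K.powerset, (∏ k ∈ T, sg (B k)) *
        ((∑ m ∈ F n, ∏ k ∈ T, sg (b (k * m))) / (F n).card)) atTop
      (nhds ((1/2 : ℝ) ^ K.card * ∑ T ∈ K.powerset, if T = ∅ then (1:ℝ) else 0)) := by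
    refine Tendsto.const_mul _ (tendsto_finsetSum _ fun T hT => ?_)
    by_cases h : T = ∅
    · subst h
      simp only [Finset.prod_empty, Finset.sum_const, nsmul_eq_mul, mul_one, one_mul, if_true]
      refine tendsto_const_nhds.congr fun n => ?_
      have : ((F n).card : ℝ) ≠ 0 := by
        exact_mod_cast (Finset.card_pos.2 (hne n)).ne'
      rw [div_self this]
    · rw [if_neg h]
      have := (hb T (Finset.nonempty_iff_ne_empty.2 h)
        (fun k hk => hp k (Finset.mem_powerset.1 hT hk))).const_mul (∏ k ∈ T, sg (B k))
      simpa using this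
  simpa using lim

/-- Divisors of `L` in a multiplicative window of ratio `2^j`. -/
lemma card_window (L : ℕ) (hL : 0 < L) (k M j : ℕ) :
    (L.divisors.filter (fun m => M ≤ k * m ∧ k * m < 2 ^ j * M)).card * (L.factorization 2 + 1)
      ≤ j * L.divisors.card := by
  set s := L.divisors.filter (fun m => M ≤ k * m ∧ k * m < 2 ^ j * M) with hs
  have hD : L.divisors.card = (L.factorization 2 + 1) * (L / 2 ^ L.factorization 2).divisors.card := by
    conv_lhs => rw [← Nat.ordProj_mul_ordCompl_eq_self L 2]
    rw [Nat.Coprime.card_divisors_mul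
      (Nat.Coprime.pow_left _ (Nat.coprime_ordCompl Nat.prime_two hL.ne')),
      Nat.divisors_prime_pow Nat.prime_two]
    simp
  have h1 : s.card ≤ j * (s.image (fun m => m / 2 ^ m.factorization 2)).card := by
    refine Finset.card_le_mul_card_image s j fun d _ => ?_
    rcases (s.filter (fun m => m / 2 ^ m.factorization 2 = d)).eq_empty_or_nonempty with h | h
    · rw [h]; simp
    · have hdec : ∀ m ∈ s.filter (fun m => m / 2 ^ m.factorization 2 = d),
          2 ^ m.factorization 2 * d = m ∧ 0 < m ∧ M ≤ k * m ∧ k * m < 2 ^ j * M := by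
        intro m hm
        simp only [hs, Finset.mem_filter, Nat.mem_divisors] at hm
        refine ⟨?_, Nat.pos_of_dvd_of_pos hm.1.1.1 hL, hm.1.2⟩
        rw [← hm.2]; exact Nat.ordProj_mul_ordCompl_eq_self m 2
      obtain ⟨m0, hm0, hmin⟩ := Finset.exists_min_image _ id h
      have h0 := hdec m0 hm0
      have hdpos : 0 < d := by
        rcases Nat.eq_zero_or_pos d with hd | hd
        · have := h0.1; rw [hd] at this; omega
        · exact hd
      have := Finset.card_le_card_of_injOn (s := s.filter (fun m => m / 2 ^ m.factorization 2 = d))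
        (t := Finset.Ico (m0.factorization 2) (m0.factorization 2 + j)) (fun m => m.factorization 2)
        ?_ ?_
      · simpa using this
      · intro m hm
        have h1 := hdec m hm
        have hle : m0 ≤ m := hmin m hm
        simp only [Finset.coe_Ico, Set.mem_Ico]
        constructor
        · rw [← h0.1, ← h1.1] at hle
          exact (Nat.pow_le_pow_iff_right (by norm_num)).1 (Nat.le_of_mul_le_mul_right hle hdpos)
        · have : k * m < 2 ^ j * (k * m0) :=
            lt_of_lt_of_le h1.2.2.2 (Nat.mul_le_mul_left _ h0.2.2.1)
          have h2 : m < 2 ^ j * m0 := by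
            refine Nat.lt_of_mul_lt_mul_left (a := k) ?_
            calc k * m < 2 ^ j * (k * m0) := this
              _ = k * (2 ^ j * m0) := by ring
          rw [← h0.1, ← h1.1, ← mul_assoc, ← pow_add] at h2
          have h3 := (Nat.pow_lt_pow_iff_right (by norm_num)).1 (Nat.lt_of_mul_lt_mul_right h2)
          omega
      · intro m hm m' hm' hmm
        have h1 := (hdec m hm).1
        have h2 := (hdec m' hm').1
        simp only at hmm
        rw [← h1, ← h2, hmm]
  have h2 : (s.image (fun m => m / 2 ^ m.factorization 2)).card ≤
      (L / 2 ^ L.factorization 2).divisors.card := by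
    refine Finset.card_le_card fun d hd => ?_
    simp only [hs, Finset.mem_image, Finset.mem_filter, Nat.mem_divisors] at hd
    obtain ⟨m, hm, rfl⟩ := hd
    rw [Nat.mem_divisors]
    exact ⟨Nat.ordCompl_dvd_ordCompl_of_dvd hm.1.1 2, (Nat.ordCompl_pos 2 hL.ne').ne'⟩
  rw [hD]
  calc s.card * (L.factorization 2 + 1) ≤ (j * (L / 2 ^ L.factorization 2).divisors.card) *
        (L.factorization 2 + 1) := Nat.mul_le_mul_right _ (h1.trans (Nat.mul_le_mul_left _ h2))
    _ = _ := by ring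

open Classical in
lemma exists_windows (L : ℕ → ℕ) (hpos : ∀ n, 0 < L n) (hdvd : ∀ n, L n ∣ L (n + 1))
    (hall : ∀ m : ℕ, 0 < m → ∀ᶠ n in atTop, m ∣ L n) :
    ∃ M : ℕ → ℕ, (∀ j, 2 ≤ M j) ∧ ∀ k, 0 < k → Tendsto (fun n =>
      (((L n).divisors.filter (fun m => ∃ j, M j ≤ k * m ∧ k * m < 2 ^ j * M j)).card : ℝ) /
        (L n).divisors.card) atTop (nhds 0) := by
  have hmono : Monotone L := monotone_nat_of_le_succ fun n => Nat.le_of_dvd (hpos _) (hdvd n)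
  have hN : ∀ j : ℕ, ∃ N, ∀ n ≥ N, 2 ^ (j * 2 ^ j) ∣ L n := fun j =>
    eventually_atTop.1 (hall (2 ^ (j * 2 ^ j)) (by positivity))
  choose N hN using hN
  refine ⟨fun j => j * L (N j) + 2, fun j => Nat.le_add_left _ _, fun k hk => ?_⟩
  set M : ℕ → ℕ := fun j => j * L (N j) + 2 with hM
  have hMj : ∀ j, j < M j := fun j => by
    have := Nat.le_mul_of_pos_right j (hpos (N j)); simp only [hM]; omega
  have hDpos : ∀ n, (0:ℝ) < (L n).divisors.card := fun n => by
    exact_mod_cast Finset.card_pos.2 ⟨1, Nat.one_mem_divisors.2 (hpos n).ne'⟩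
  let bad : ℕ → ℕ → Finset ℕ := fun n j =>
    (L n).divisors.filter (fun m => M j ≤ k * m ∧ k * m < 2 ^ j * M j)
  have hw : ∀ n j, (bad n j).card * ((L n).factorization 2 + 1) ≤ j * (L n).divisors.card :=
    fun n j => card_window (L n) (hpos n) k (M j) j
  let p : ℕ → ℕ → ℝ := fun n j => ((bad n j).card : ℝ) / (L n).divisors.card
  let bound : ℕ → ℝ := fun j => if j < k then 1 else (1/2) ^ j
  have hbs : Summable bound := by
    rw [← summable_nat_add_iff k]
    have : Summable (fun j : ℕ => ((1:ℝ)/2) ^ (j + k)) :=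
      (summable_nat_add_iff k).2 summable_geometric_two
    refine this.congr fun j => ?_
    simp [bound]
  have hp0 : ∀ n j, 0 ≤ p n j := fun n j => by positivity
  have hbd : ∀ n j, p n j ≤ bound j := by
    intro n j
    simp only [bound]
    split_ifs with hj
    · rw [div_le_one (hDpos n)]
      exact_mod_cast Finset.card_filter_le _ _
    · rcases (bad n j).eq_empty_or_nonempty with h | ⟨m, hm⟩
      · simp only [p, h]; simp
      · simp only [bad, Finset.mem_filter, Nat.mem_divisors] at hm
        have hmL : m ≤ L n := Nat.le_of_dvd (hpos n) hm.1.1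
        have h1 : j * L (N j) < j * L n := by
          have a1 : k * m ≤ j * L n := Nat.mul_le_mul (not_lt.1 hj) hmL
          have a2 := hm.2.1
          simp only [hM] at a2
          omega
        have h2 : N j ≤ n := by
          by_contra hcon
          have := hmono (le_of_not_ge hcon)
          exact absurd (Nat.mul_le_mul_left j this) (not_le.2 h1)
        have h3 := (Nat.prime_two.pow_dvd_iff_le_factorization (hpos n).ne').1 (hN j n h2)
        have hj0 : 0 < j := lt_of_lt_of_le hk (not_lt.1 hj)
        have h4 : (bad n j).card * 2 ^ j ≤ (L n).divisors.card := by
          refine Nat.le_of_mul_le_mul_left ?_ hj0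
          calc j * ((bad n j).card * 2 ^ j) = (bad n j).card * (j * 2 ^ j) := by ring
            _ ≤ (bad n j).card * ((L n).factorization 2 + 1) := Nat.mul_le_mul_left _ (by omega)
            _ ≤ _ := hw n j
        simp only [p]
        rw [div_le_iff₀ (hDpos n), one_div, inv_pow, inv_mul_eq_div, le_div_iff₀ (by positivity)]
        exact_mod_cast h4
  have hfac : Tendsto (fun n => (L n).factorization 2) atTop atTop := by
    rw [tendsto_atTop]
    intro A
    filter_upwards [hall (2 ^ A) (by positivity)] with n hn
    exact (Nat.prime_two.pow_dvd_iff_le_factorization (hpos n).ne').1 hn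
  have hpt : ∀ j, Tendsto (fun n => p n j) atTop (nhds 0) := by
    intro j
    have hlim : Tendsto (fun n => (j:ℝ) / (((L n).factorization 2 : ℕ) + 1 : ℝ)) atTop (nhds 0) := by
      refine Tendsto.const_div_atTop ?_ _
      exact tendsto_atTop_add_const_right _ _ (tendsto_natCast_atTop_atTop.comp hfac)
    refine squeeze_zero (fun n => hp0 n j) (fun n => ?_) hlim
    simp only [p]
    rw [div_le_div_iff₀ (hDpos n) (by positivity)]
    exact_mod_cast hw n j
  have hT := tendsto_tsum_of_dominated_convergence (f := p) (g := fun _ => 0) hbs hpt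
    (Eventually.of_forall fun n j => by rw [Real.norm_of_nonneg (hp0 n j)]; exact hbd n j)
  rw [tsum_zero] at hT
  refine squeeze_zero (fun n => by positivity) (fun n => ?_) hT
  have hsum : Summable (p n) := Summable.of_nonneg_of_le (hp0 n) (hbd n) hbs
  refine le_trans ?_ (hsum.sum_le_tsum (Finset.range (k * L n + 1)) (fun j _ => hp0 n j))
  simp only [p]
  rw [← Finset.sum_div]
  refine div_le_div_of_nonneg_right ?_ (hDpos n).le
  have : ((L n).divisors.filter (fun m => ∃ j, M j ≤ k * m ∧ k * m < 2 ^ j * M j)) ⊆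
      (Finset.range (k * L n + 1)).biUnion (bad n) := by
    intro m hm
    rw [Finset.mem_filter] at hm
    obtain ⟨hm, j, hj1, hj2⟩ := hm
    rw [Finset.mem_biUnion]
    refine ⟨j, ?_, Finset.mem_filter.2 ⟨hm, hj1, hj2⟩⟩
    have := Nat.mul_le_mul_left k (Nat.le_of_dvd (hpos n) (Nat.dvd_of_mem_divisors hm))
    have := hMj j
    rw [Finset.mem_range]; omega
  exact_mod_cast (Finset.card_le_card this).trans Finset.card_biUnion_le

lemma filter_card_le (F K : Finset ℕ) (a b B : ℕ → Bool) (Z : ℕ → Prop) [DecidablePred Z]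
    (hab : ∀ m, ¬ Z m → a m = b m) :
    (F.filter (fun m => ∀ k ∈ K, a (k * m) = B k)).card ≤
      (F.filter (fun m => ∀ k ∈ K, b (k * m) = B k)).card +
        ∑ k ∈ K, (F.filter (fun m => Z (k * m))).card := by
  have : F.filter (fun m => ∀ k ∈ K, a (k * m) = B k) ⊆
      F.filter (fun m => ∀ k ∈ K, b (k * m) = B k) ∪
        K.biUnion (fun k => F.filter (fun m => Z (k * m))) := by
    intro m hm
    rw [Finset.mem_filter] at hm
    rw [Finset.mem_union, Finset.mem_biUnion]
    by_cases h : ∃ k ∈ K, Z (k * m)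
    · obtain ⟨k, hk, hz⟩ := h
      exact Or.inr ⟨k, hk, Finset.mem_filter.2 ⟨hm.1, hz⟩⟩
    · push Not at h
      refine Or.inl (Finset.mem_filter.2 ⟨hm.1, fun k hk => ?_⟩)
      rw [← hab _ (h k hk)]; exact hm.2 k hk
  calc _ ≤ _ := Finset.card_le_card this
    _ ≤ _ := Finset.card_union_le _ _
    _ ≤ _ := Nat.add_le_add_left Finset.card_biUnion_le _

lemma normal_modify (F : ℕ → Finset ℕ) (K : Finset ℕ) (hp : ∀ k ∈ K, 0 < k)
    (a b B : ℕ → Bool) (Z : ℕ → Prop) [DecidablePred Z] (hab : ∀ m, ¬ Z m → a m = b m) (c : ℝ)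
    (hZ : ∀ k, 0 < k → Tendsto (fun n => (((F n).filter (fun m => Z (k * m))).card : ℝ) /
      (F n).card) atTop (nhds 0))
    (hb : Tendsto
      (fun n => (((F n).filter (fun m => ∀ k ∈ K, b (k * m) = B k)).card : ℝ) / (F n).card)
      atTop (nhds c)) :
    Tendsto
      (fun n => (((F n).filter (fun m => ∀ k ∈ K, a (k * m) = B k)).card : ℝ) / (F n).card)
      atTop (nhds c) := by
  have hs : Tendsto (fun n => ∑ k ∈ K, (((F n).filter (fun m => Z (k * m))).card : ℝ) /
      (F n).card) atTop (nhds 0) := by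
    simpa using tendsto_finsetSum K fun k hk => hZ k (hp k hk)
  have hlo := hb.sub hs
  have hhi := hb.add hs
  rw [sub_zero] at hlo
  rw [add_zero] at hhi
  refine tendsto_of_tendsto_of_tendsto_of_le_of_le hlo hhi (fun n => ?_) (fun n => ?_)
  · simp only
    rw [← Finset.sum_div, ← sub_div]
    refine div_le_div_of_nonneg_right ?_ (by positivity)
    rw [sub_le_iff_le_add]
    exact_mod_cast filter_card_le (F n) K b a B Z (fun m hm => (hab m hm).symm)
  · simp only
    rw [← Finset.sum_div, ← add_div]
    refine div_le_div_of_nonneg_right ?_ (by positivity)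
    exact_mod_cast filter_card_le (F n) K a b B Z hab

lemma liouville_of_windows (a : ℕ → Bool) (M : ℕ → ℕ) (hM : ∀ j, 2 ≤ M j)
    (hz : ∀ j m, M j ≤ m → m < 2 ^ j * M j → a m = false)
    (hinf : ∀ N, ∃ m, N < m ∧ a m = true) :
    Liouville (∑' n : ℕ, (if a (n + 1) then (1 : ℝ) / 2 ^ (n + 1) else 0)) ∧
    (∑' n : ℕ, (if a (n + 1) then (1 : ℝ) / 2 ^ (n + 1) else 0)) ∈ Set.Ioo (0:ℝ) 1 := by
  set f : ℕ → ℝ := fun n => if a (n + 1) then (1 : ℝ) / 2 ^ (n + 1) else 0 with hf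
  have hg : HasSum (fun n : ℕ => (1:ℝ) / 2 ^ (n+1)) 1 := by
    convert hasSum_geometric_two' 1 using 2 with n
    rw [pow_succ]; field_simp
  have f0 : ∀ n, 0 ≤ f n := by intro n; simp only [hf]; split_ifs <;> positivity
  have fg : ∀ n, f n ≤ (1:ℝ) / 2 ^ (n+1) := by
    intro n; simp only [hf]; split_ifs
    · exact le_rfl
    · positivity
  have fs : Summable f := Summable.of_nonneg_of_le f0 fg hg.summable
  have htp : ∀ N, 0 < ∑' i, f (i + N) := by
    intro N
    obtain ⟨m, hm, ham⟩ := hinf N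
    refine ((summable_nat_add_iff N).2 fs).tsum_pos (fun i => f0 _) (m - N - 1) ?_
    have e : m - N - 1 + N + 1 = m := by omega
    simp only [hf, e, ham, if_true]
    positivity
  have htu : ∀ N, ∑' i, f (i + N) ≤ 1 / 2 ^ N := by
    intro N
    have h2 : HasSum (fun n : ℕ => (1:ℝ) / 2 ^ N * (1 / 2 ^ (n+1))) (1 / 2 ^ N * 1) := hg.mul_left _
    rw [mul_one] at h2
    refine hasSum_le (fun i => ?_) ((summable_nat_add_iff N).2 fs).hasSum h2
    refine (fg _).trans (le_of_eq ?_)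
    rw [div_mul_div_comm, one_mul, ← pow_add]
    congr 2; omega
  refine ⟨fun n => ?_, ?_, ?_⟩
  · have hMn := hM n
    set Q := M n - 1 with hQ
    refine ⟨∑ i ∈ Finset.range Q, (if a (i+1) then 2 ^ (Q - (i+1)) else 0), 2 ^ Q, ?_, ?_⟩
    · exact one_lt_pow₀ (by norm_num) (by omega)
    have hpq : ((∑ i ∈ Finset.range Q, (if a (i+1) then 2 ^ (Q - (i+1)) else 0) : ℤ) : ℝ) /
        ((2 ^ Q : ℤ) : ℝ) = ∑ i ∈ Finset.range Q, f i := by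
      push_cast
      rw [Finset.sum_div]
      refine Finset.sum_congr rfl fun i hi => ?_
      rw [Finset.mem_range] at hi
      simp only [hf]
      split_ifs
      · rw [div_eq_div_iff (by positivity) (by positivity), one_mul, ← pow_add]
        congr 1; omega
      · simp
    rw [hpq, ← fs.sum_add_tsum_nat_add Q, add_sub_cancel_left]
    refine ⟨?_, ?_⟩
    · have := htp Q; intro h; linarith
    rw [abs_of_pos (htp Q)]
    set R := 2 ^ n * M n - 1 with hR
    have hn : n + 1 ≤ 2 ^ n := Nat.lt_two_pow_self
    have hnM : (n + 1) * M n ≤ 2 ^ n * M n := Nat.mul_le_mul_right _ hn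
    have hQR : Q ≤ R := by
      have : 1 * M n ≤ 2 ^ n * M n := Nat.mul_le_mul_right _ (by omega)
      omega
    have hRQ : ∑' i, f (i + Q) = ∑' i, f (i + R) := by
      have h1 := fs.sum_add_tsum_nat_add Q
      have h2 := fs.sum_add_tsum_nat_add R
      have h3 : ∑ i ∈ Finset.range R, f i = ∑ i ∈ Finset.range Q, f i := by
        symm
        refine Finset.sum_subset (Finset.range_mono hQR) fun i hi hi' => ?_
        rw [Finset.mem_range] at hi hi'
        simp only [hf]
        rw [hz n (i+1) (by omega) (by omega)]
        simp
      linarith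
    rw [hRQ]
    refine lt_of_le_of_lt (htu R) ?_
    push_cast
    rw [← pow_mul]
    refine one_div_lt_one_div_of_lt (by positivity) (pow_lt_pow_right₀ (by norm_num) ?_)
    have e1 : M n = Q + 1 := by omega
    rw [e1] at hnM hR
    have : Q * n + n + Q + 1 ≤ 2 ^ n * (Q + 1) := by nlinarith
    omega
  · simpa using htp 0
  · rw [← hg.tsum_eq]
    have hM1 := hM 1
    refine fs.tsum_lt_tsum (i := M 1 - 1) fg ?_ hg.summable
    simp only [hf, hz 1 (M 1 - 1 + 1) (by omega) (by omega)]
    simp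

/-- For every nice Følner sequence `(F n)` in `(ℕ,×)` there exists an `(F n)`-normal
Liouville number: a Liouville number `x ∈ (0,1)` whose binary digit sequence
`a : ℕ → {0,1}` (so `x = ∑_{n ≥ 1} a n · 2^{-n}`) is `(F n)`-normal in `(ℕ,×)`. -/
theorem exists_mulNormal_liouville
    (F : ℕ → Finset ℕ) (hF : NiceFolner F) :
    ∃ (x : ℝ) (a : ℕ → Bool), Liouville x ∧ x ∈ Set.Ioo (0 : ℝ) 1 ∧
      x = ∑' n : ℕ, (if a (n + 1) then (1 : ℝ) / 2 ^ (n + 1) else 0) ∧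
      MulNormalFun F a := by
  classical
  obtain ⟨L, hpos, hdvd, hne, hall, hFL⟩ := hF
  have hsub : ∀ n, F n ⊂ F (n + 1) := by
    intro n
    rw [hFL, hFL, Finset.ssubset_iff_subset_ne]
    refine ⟨Nat.divisors_subset_of_dvd (hpos _).ne' (hdvd n), fun h => ?_⟩
    have h1 : L (n+1) ∈ (L n).divisors := by
      rw [h]; exact Nat.mem_divisors_self _ (hpos _).ne'
    exact hne n (Nat.dvd_antisymm (hdvd n) (Nat.dvd_of_mem_divisors h1))
  have h0 : ∀ n, 0 ∉ F n := by intro n; rw [hFL]; simp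
  have hnon : ∀ n, (F n).Nonempty := fun n => by
    rw [hFL]; exact ⟨1, Nat.one_mem_divisors.2 (hpos n).ne'⟩
  obtain ⟨b, hb⟩ := exists_uncorrelated F hsub h0
  obtain ⟨M, hM2, hM⟩ := exists_windows L hpos hdvd hall
  let Z : ℕ → Prop := fun m => ∃ j, M j ≤ m ∧ m < 2 ^ j * M j
  let a : ℕ → Bool := fun m => if Z m then false else b m
  have hab : ∀ m, ¬ Z m → a m = b m := fun m hm => by simp only [a, if_neg hm]
  have hnorm : MulNormalFun F a := by
    intro K _ hp B
    refine normal_modify F K hp a b B Z hab _ (fun k hk => ?_)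
      (normal_of_uncorrelated F hnon b hb K hp B)
    have := hM k hk
    simp_rw [← hFL] at this
    convert this using 4
  have hcard : StrictMono (fun n => (F n).card) :=
    strictMono_nat_of_lt_succ fun n => Finset.card_lt_card (hsub n)
  have hinf : ∀ N, ∃ m, N < m ∧ a m = true := by
    intro N
    by_contra hcon
    push Not at hcon
    have h1 := hnorm {1} (by simp) (by simp) (fun _ => true)
    have h2 : Tendsto (fun n => ((N + 1 : ℕ) : ℝ) / (F n).card) atTop (nhds 0) :=
      Tendsto.const_div_atTop (tendsto_natCast_atTop_atTop.comp hcard.tendsto_atTop) _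
    have h3 := le_of_tendsto_of_tendsto' h1 h2 fun n => by
      refine div_le_div_of_nonneg_right ?_ (by positivity)
      rw [← Finset.card_range (N + 1)]
      refine Nat.cast_le.2 (Finset.card_le_card fun m hm => ?_)
      simp only [Finset.mem_filter, Finset.mem_singleton, forall_eq, one_mul] at hm
      rw [Finset.mem_range]
      by_contra hlt
      exact hcon m (by omega) hm.2
    norm_num at h3
  obtain ⟨hl, hx⟩ := liouville_of_windows a M hM2
    (fun j m h1 h2 => by simp only [a]; rw [if_pos ⟨j, h1, h2⟩]) hinf
  exact ⟨_, a, hl, hx, rfl, hnorm⟩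
end
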